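/- arXiv:1112.1511 — 3 statements merged into one kernel-verified Lean document; each statement's English description precedes it below -/
import Mathlib

section
/- Let n ≥ 2, let P be a nonzero polynomial on ℝⁿ, and set N_P := sup{d(P·h) : h a harmonic polynomial on ℝⁿ}. Let μ and ν be finite non-negative measures on ℝⁿ whose supports are contained in K_P(R) for some R > 0. Then μ = ν if and only if ∫ Q dμ = ∫ Q dν for every polynomial Q on ℝⁿ with Δ^{N_P} Q = 0. -/
open MeasureTheory Metric MvPolynomial

noncomputable section

/-- `ℝⁿ` as a Euclidean space. -/
abbrev En (n : ℕ) : Type := EuclideanSpace ℝ (Fin n)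

/-- The Laplace operator `Δ = ∂²/∂x₁² + … + ∂²/∂xₙ²` acting on polynomials. -/
def lap (n : ℕ) (P : MvPolynomial (Fin n) ℂ) : MvPolynomial (Fin n) ℂ :=
  ∑ i : Fin n, pderiv i (pderiv i P)

/-- A polynomial is harmonic if `ΔP = 0`. -/
def IsHarmonicPoly (n : ℕ) (P : MvPolynomial (Fin n) ℂ) : Prop := lap n P = 0

/-- The polyharmonic degree `d(P) = min {N : Δ^(N+1) P = 0}`. -/
def pdeg (n : ℕ) (P : MvPolynomial (Fin n) ℂ) : ℕ := sInf {N : ℕ | (lap n)^[N + 1] P = 0}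

/-- Evaluation of a polynomial at a real point of `ℝⁿ`. -/
def evalR {n : ℕ} (P : MvPolynomial (Fin n) ℂ) (x : En n) : ℂ :=
  eval (fun i => (x i : ℂ)) P

/-- Evaluation of a polynomial at `ζθ`, i.e. after substituting `ζ θ i` for `x i`. -/
def evalC {n : ℕ} (P : MvPolynomial (Fin n) ℂ) (ζ : ℂ) (θ : En n) : ℂ :=
  eval (fun i => ζ * (θ i : ℂ)) P

/-- The surface measure on the unit sphere `S^{n-1} ⊂ ℝⁿ`. -/
def sphereMeasure (n : ℕ) : Measure (sphere (0 : En n) 1) :=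
  (volume : Measure (En n)).toSphere

/-- `ω_n`, the surface area of the unit sphere `S^{n-1}`. -/
def omegaN (n : ℕ) : ℝ := ((sphereMeasure n) Set.univ).toReal

/-- The analytic continuation of `ζ ↦ r(ζθ − x)ⁿ = |ζθ − x|ⁿ` to `|ζ| > |x|`
(principal branch; for real `ζ = ρ > |x|` it equals `|ρθ − x|ⁿ`, for `θ` on the
unit sphere). -/
def rPow (n : ℕ) (ζ : ℂ) (θ x : En n) : ℂ :=
  ζ ^ n * (1 - 2 * ((inner ℝ θ x : ℝ) : ℂ) / ζ + ((‖x‖ : ℂ)) ^ 2 / ζ ^ 2) ^ ((n : ℂ) / 2)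

/-- Integral of a complex-valued function against a finite signed measure
(via the Jordan decomposition). -/
def sInt {α : Type*} [MeasurableSpace α] (μ : SignedMeasure α) (f : α → ℂ) : ℂ :=
  ∫ x, f x ∂μ.toJordanDecomposition.posPart - ∫ x, f x ∂μ.toJordanDecomposition.negPart

/-- The support of the signed measure `μ` is contained in the set `s`. -/
def SuppIn {α : Type*} [MeasurableSpace α] (μ : SignedMeasure α) (s : Set α) : Prop :=
  μ.totalVariation sᶜ = 0

/-- The multivariate Markov transform of a finite signed measure. -/
def markov {n : ℕ} (μ : SignedMeasure (En n)) (ζ : ℂ) (θ : En n) : ℂ :=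
  (omegaN n : ℂ)⁻¹ * sInt μ fun x => ζ ^ (n - 1) / rPow n ζ θ x

/-- The multivariate Markov transform of a (nonnegative) measure. -/
def markovM {n : ℕ} (μ : Measure (En n)) (ζ : ℂ) (θ : En n) : ℂ :=
  (omegaN n : ℂ)⁻¹ * ∫ x, ζ ^ (n - 1) / rPow n ζ θ x ∂μ

/-- The function of the second kind `Q_P` for a signed measure. -/
def qP {n : ℕ} (μ : SignedMeasure (En n)) (P : MvPolynomial (Fin n) ℂ) (ζ : ℂ) (θ : En n) : ℂ :=
  (omegaN n : ℂ)⁻¹ * sInt μ fun x => (evalC P ζ θ - evalR P x) * ζ ^ (n - 1) / rPow n ζ θ x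

/-- The function of the second kind `Q_P` for a (nonnegative) measure. -/
def qPM {n : ℕ} (μ : Measure (En n)) (P : MvPolynomial (Fin n) ℂ) (ζ : ℂ) (θ : En n) : ℂ :=
  (omegaN n : ℂ)⁻¹ * ∫ x, (evalC P ζ θ - evalR P x) * ζ ^ (n - 1) / rPow n ζ θ x ∂μ

/-- The rest function `R_P` for a signed measure. -/
def restP {n : ℕ} (μ : SignedMeasure (En n)) (P : MvPolynomial (Fin n) ℂ) (ζ : ℂ) (θ : En n) : ℂ :=
  (omegaN n : ℂ)⁻¹ * sInt μ fun x => evalR P x * ζ ^ (n - 1) / rPow n ζ θ x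

/-- The Laplacian as a linear endomorphism. -/
def lapL (n : ℕ) : Module.End ℂ (MvPolynomial (Fin n) ℂ) where
  toFun := lap n
  map_add' f g := by simp [lap, Finset.sum_add_distrib]
  map_smul' c f := by simp [lap, Finset.smul_sum]

/-- The squared radius polynomial. -/
def rr (n : ℕ) : MvPolynomial (Fin n) ℂ := ∑ i : Fin n, X i ^ 2

lemma lapL_apply (n : ℕ) (f : MvPolynomial (Fin n) ℂ) :
    lapL n f = ∑ i : Fin n, pderiv i (pderiv i f) := rfl

lemma lapL_pow (n k : ℕ) (f : MvPolynomial (Fin n) ℂ) : (lapL n ^ k) f = (lap n)^[k] f := by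
  rw [Module.End.pow_apply]; rfl

lemma lapL_pow_succ (n k : ℕ) (f : MvPolynomial (Fin n) ℂ) :
    (lapL n ^ (k + 1)) f = (lapL n ^ k) (lapL n f) := by
  rw [pow_succ]; rfl

lemma lapL_pow_zero (n : ℕ) (f : MvPolynomial (Fin n) ℂ) :
    (lapL n ^ 0) f = f := by
  rw [pow_zero]; rfl

lemma lapL_pow_mono {n a b : ℕ} (hab : a ≤ b) {f : MvPolynomial (Fin n) ℂ}
    (h : (lapL n ^ a) f = 0) : (lapL n ^ b) f = 0 := by
  obtain ⟨c, rfl⟩ := Nat.exists_eq_add_of_le hab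
  rw [add_comm, pow_add, Module.End.mul_apply, h, map_zero]

lemma lapL_mul (n : ℕ) (f g : MvPolynomial (Fin n) ℂ) :
    lapL n (f * g) = lapL n f * g + 2 * ∑ i, pderiv i f * pderiv i g + f * lapL n g := by
  simp only [lapL_apply, Finset.sum_mul, Finset.mul_sum, ← Finset.sum_add_distrib]
  refine Finset.sum_congr rfl fun i _ => ?_
  simp only [pderiv_mul, map_add]
  ring

lemma pderiv_comm' {n : ℕ} (i j : Fin n) (f : MvPolynomial (Fin n) ℂ) :
    pderiv i (pderiv j f) = pderiv j (pderiv i f) := by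
  induction f using MvPolynomial.induction_on' with
  | monomial u a =>
    by_cases hij : i = j
    · rw [hij]
    · simp only [pderiv_monomial]
      congr 1
      · rw [tsub_right_comm]
      · have : ¬ j = i := fun h => hij h.symm
        simp [hij, this]; ring
  | add p q hp hq => simp [hp, hq]

lemma lapL_pderiv {n : ℕ} (i : Fin n) (f : MvPolynomial (Fin n) ℂ) :
    lapL n (pderiv i f) = pderiv i (lapL n f) := by
  simp only [lapL_apply, map_sum]
  refine Finset.sum_congr rfl fun j _ => ?_
  rw [pderiv_comm' j i f, pderiv_comm' j i]

lemma lapL_pow_pderiv {n : ℕ} (k : ℕ) (i : Fin n) (f : MvPolynomial (Fin n) ℂ) :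
    (lapL n ^ k) (pderiv i f) = pderiv i ((lapL n ^ k) f) := by
  induction k generalizing f with
  | zero => simp
  | succ k ih => rw [lapL_pow_succ, lapL_pow_succ, lapL_pderiv, ih]

lemma hom_zero_eq_C {n : ℕ} {f : MvPolynomial (Fin n) ℂ} (hf : f.IsHomogeneous 0) :
    ∃ c, f = C c := by
  rw [← totalDegree_zero_iff_isHomogeneous, totalDegree_eq_zero_iff_eq_C] at hf
  exact ⟨_, hf⟩

lemma pderiv_hom_zero {n : ℕ} {f : MvPolynomial (Fin n) ℂ} (hf : f.IsHomogeneous 0)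
    (i : Fin n) : pderiv i f = 0 := by
  obtain ⟨c, rfl⟩ := hom_zero_eq_C hf
  simp

lemma lapL_hom {n e : ℕ} {f : MvPolynomial (Fin n) ℂ} (hf : f.IsHomogeneous e) :
    (lapL n f).IsHomogeneous (e - 2) := by
  rw [lapL_apply]
  exact IsHomogeneous.sum _ _ _ fun i _ => hf.pderiv.pderiv

lemma lapL_small {n e : ℕ} (he : e < 2) {f : MvPolynomial (Fin n) ℂ}
    (hf : f.IsHomogeneous e) : lapL n f = 0 := by
  rw [lapL_apply]
  refine Finset.sum_eq_zero fun i _ => pderiv_hom_zero ?_ i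
  have : e - 1 = 0 := by omega
  rw [← this]
  exact hf.pderiv

lemma rr_hom (n : ℕ) : (rr n).IsHomogeneous 2 :=
  IsHomogeneous.sum _ _ _ fun i _ => isHomogeneous_X_pow i 2

lemma lapL_rr_mul {n e : ℕ} {f : MvPolynomial (Fin n) ℂ} (hf : f.IsHomogeneous e) :
    lapL n (rr n * f) = (2 * n + 4 * e : ℂ) • f + rr n * lapL n f := by
  have h1 : ∀ i : Fin n, pderiv i (rr n) = 2 * X i := by
    intro i
    rw [rr, map_sum, Finset.sum_eq_single i]
    · simp
    · intro j _ hj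
      simp [pderiv_X_of_ne hj]
    · simp
  have h2 : lapL n (rr n) = C (2 * n : ℂ) := by
    rw [lapL_apply]
    have : ∀ i : Fin n, pderiv i (pderiv i (rr n)) = 2 := by
      intro i
      have h3 : (2 : MvPolynomial (Fin n) ℂ) = C 2 := rfl
      rw [h1, h3, pderiv_C_mul]; simp
    have h4 : (C 2 : MvPolynomial (Fin n) ℂ) = 2 := rfl
    simp [this, h4]
    ring
  rw [lapL_mul, h2]
  have h3 : ∑ i, pderiv i (rr n) * pderiv i f = 2 * (e • f) := by
    rw [← hf.sum_X_mul_pderiv, Finset.mul_sum]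
    refine Finset.sum_congr rfl fun i _ => ?_
    rw [h1]; ring
  rw [h3, add_smul, smul_eq_C_mul, smul_eq_C_mul, nsmul_eq_mul]
  have h4 : (C 4 : MvPolynomial (Fin n) ℂ) = 4 := rfl
  congr 2
  simp [h4]
  ring

lemma lapL_pow_mul_eq_zero {n : ℕ} (s : ℕ) : ∀ (b l : ℕ) (w q : MvPolynomial (Fin n) ℂ),
    b + l ≤ s → (lapL n ^ b) w = 0 → q.IsHomogeneous l → (lapL n ^ s) (q * w) = 0 := by
  induction s with
  | zero =>
    intro b l w q h hw hq
    have : b = 0 := by omega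
    subst this
    rw [lapL_pow_zero] at hw
    simp [hw]
  | succ s ih =>
    intro b l w q h hw hq
    rcases b with _ | b
    · rw [lapL_pow_zero] at hw
      simp [hw]
    rw [lapL_pow_succ, lapL_mul, map_add, map_add]
    have e1 : (lapL n ^ s) (q * lapL n w) = 0 :=
      ih b l _ _ (by omega) (by rw [← lapL_pow_succ]; exact hw) hq
    have e2 : (lapL n ^ s) (lapL n q * w) = 0 := by
      by_cases hl : l < 2
      · rw [lapL_small hl hq]; simp
      · exact ih (b + 1) (l - 2) _ _ (by omega) hw (lapL_hom hq)
    have e3 : (lapL n ^ s) (2 * ∑ i, pderiv i q * pderiv i w) = 0 := by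
      have h3 : (2 : MvPolynomial (Fin n) ℂ) = C 2 := rfl
      rw [h3, ← smul_eq_C_mul, map_smul, map_sum, Finset.sum_eq_zero, smul_zero]
      intro i _
      rcases l with _ | l
      · rw [pderiv_hom_zero hq]; simp
      · exact ih (b + 1) l _ _ (by omega) (by rw [lapL_pow_pderiv, hw, map_zero]) hq.pderiv
    rw [e1, e2, e3]; simp

lemma lapL_pow_hom {n e : ℕ} {f : MvPolynomial (Fin n) ℂ} (hf : f.IsHomogeneous e) :
    (lapL n ^ (e + 1)) f = 0 := by
  have := lapL_pow_mul_eq_zero (n := n) (e + 1) 1 e 1 f (by omega)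
    (by rw [pow_one]; exact lapL_small (by norm_num) (isHomogeneous_one _ _)) hf
  simpa using this

/-- Solving `α u + r² Δ u = v`. -/
lemma solve_aux {n : ℕ} (M : ℕ) : ∀ (e : ℕ) (α : ℝ) (v : MvPolynomial (Fin n) ℂ), 0 < α →
    v.IsHomogeneous e → (lapL n ^ M) v = 0 →
    ∃ u : MvPolynomial (Fin n) ℂ, u.IsHomogeneous e ∧ (lapL n ^ M) u = 0 ∧
      (α : ℂ) • u + rr n * lapL n u = v := by
  induction M with
  | zero =>
    intro e α v hα hv h
    rw [lapL_pow_zero] at h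
    exact ⟨0, isHomogeneous_zero _ _ _, by simp, by simp [h]⟩
  | succ M ih =>
    intro e α v hα hv h
    have hα' : (α : ℂ) ≠ 0 := by exact_mod_cast hα.ne'
    by_cases he : e < 2
    · refine ⟨(α : ℂ)⁻¹ • v, ?_, by rw [map_smul, h, smul_zero], ?_⟩
      · rw [smul_eq_C_mul]; exact hv.C_mul _
      · rw [map_smul, lapL_small he hv, smul_smul, mul_inv_cancel₀ hα']; simp
    obtain ⟨e, rfl⟩ : ∃ e', e = e' + 2 := ⟨e - 2, by omega⟩
    obtain ⟨y, hy, hy0, hy1⟩ := ih e (α + (2 * n + 4 * e)) (lapL n v) (by positivity)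
      (lapL_hom hv) (by rw [← lapL_pow_succ]; exact h)
    have key : lapL n ((α : ℂ)⁻¹ • (v - rr n * y)) = y := by
      rw [map_smul, map_sub, lapL_rr_mul hy, ← hy1, inv_smul_eq_iff₀ hα']
      push_cast
      rw [add_smul]
      abel
    refine ⟨(α : ℂ)⁻¹ • (v - rr n * y), ?_, ?_, ?_⟩
    · rw [smul_eq_C_mul]
      refine IsHomogeneous.C_mul (hv.sub ?_) _
      rw [add_comm]
      exact (rr_hom n).mul hy
    · rw [lapL_pow_succ, key, hy0]
    · rw [key, smul_smul, mul_inv_cancel₀ hα']; simp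

lemma gauss_step {n : ℕ} (hn : 0 < n) (M e : ℕ) (f : MvPolynomial (Fin n) ℂ)
    (hf : f.IsHomogeneous (e + 2)) (h : (lapL n ^ M) f = 0) :
    ∃ u w : MvPolynomial (Fin n) ℂ, u.IsHomogeneous e ∧ w.IsHomogeneous (e + 2) ∧
      lapL n w = 0 ∧ (lapL n ^ (M - 1)) u = 0 ∧ f = rr n * u + w := by
  have h' : (lapL n ^ (M - 1)) (lapL n f) = 0 := by
    rw [← lapL_pow_succ]; exact lapL_pow_mono (by omega) h
  obtain ⟨u, hu, hu0, hu1⟩ := solve_aux (n := n) (M - 1) e (2 * n + 4 * e) (lapL n f)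
    (by positivity) (lapL_hom hf) h'
  refine ⟨u, f - rr n * u, hu, hf.sub ?_, ?_, hu0, by ring⟩
  · rw [add_comm]; exact (rr_hom n).mul hu
  · rw [map_sub, lapL_rr_mul hu, ← hu1]; push_cast; simp

lemma lapL_pow_rr {n : ℕ} (b : ℕ) : ∀ (e : ℕ) (w : MvPolynomial (Fin n) ℂ),
    w.IsHomogeneous e → (lapL n ^ b) w = 0 → (lapL n ^ (b + 1)) (rr n * w) = 0 := by
  induction b with
  | zero =>
    intro e w _ h
    rw [lapL_pow_zero] at h
    simp [h]
  | succ b ih =>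
    intro e w hw h
    rw [lapL_pow_succ, lapL_rr_mul hw, map_add, map_smul, h,
      ih _ _ (lapL_hom hw) (by rw [← lapL_pow_succ]; exact h)]
    simp

lemma gauss_iter {n : ℕ} (hn : 0 < n) (b : ℕ) : ∀ (M m : ℕ) (f : MvPolynomial (Fin n) ℂ),
    f.IsHomogeneous (m + 2 * b) → (lapL n ^ M) f = 0 →
    ∃ u w : MvPolynomial (Fin n) ℂ, u.IsHomogeneous m ∧ w.IsHomogeneous (m + 2 * b) ∧
      (lapL n ^ b) w = 0 ∧ (lapL n ^ (M - b)) u = 0 ∧ f = rr n ^ b * u + w := by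
  induction b with
  | zero =>
    intro M m f hf h
    exact ⟨f, 0, hf, isHomogeneous_zero _ _ _, by simp, h, by simp⟩
  | succ b ih =>
    intro M m f hf h
    obtain ⟨u1, w1, hu1, hw1, hw1', hu1', rfl⟩ := gauss_step hn M (m + 2 * b) f
      (by rw [show m + 2 * b + 2 = m + 2 * (b + 1) by ring]; exact hf) h
    obtain ⟨u, w, hu, hw, hw', hu', rfl⟩ := ih (M - 1) m u1 hu1 hu1'
    have e1 : m + 2 * (b + 1) = m + 2 * b + 2 := by ring
    refine ⟨u, rr n * w + w1, hu, ?_, ?_, ?_, by ring⟩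
    · rw [e1]
      refine IsHomogeneous.add ?_ hw1
      rw [add_comm]; exact (rr_hom n).mul hw
    · rw [map_add, lapL_pow_rr b _ w hw hw', lapL_pow_succ n b w1, hw1']; simp
    · rw [show M - (b + 1) = M - 1 - b by omega]; exact hu'

lemma lapL_top_rr {n : ℕ} (hn : 0 < n) (j : ℕ) : ∃ c : ℝ, 0 < c ∧
    ∀ f : MvPolynomial (Fin n) ℂ, f.IsHomogeneous (2 * j) →
      (lapL n ^ (j + 1)) (rr n * f) = (c : ℂ) • (lapL n ^ j) f := by
  induction j with
  | zero =>
    refine ⟨2 * n, by positivity, fun f hf => ?_⟩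
    rw [lapL_pow_succ, lapL_rr_mul hf, lapL_small (by norm_num) hf]
    simp
  | succ j ih =>
    obtain ⟨c, hc, h⟩ := ih
    refine ⟨2 * n + 4 * (2 * (j + 1)) + c, by positivity, fun f hf => ?_⟩
    rw [lapL_pow_succ, lapL_rr_mul hf, map_add, map_smul, h _ (lapL_hom hf), ← lapL_pow_succ,
      ← add_smul]
    congr 1
    push_cast
    ring

lemma lapL_top_rr_pow {n : ℕ} (hn : 0 < n) (a j : ℕ) : ∃ c : ℝ, 0 < c ∧
    ∀ f : MvPolynomial (Fin n) ℂ, f.IsHomogeneous (2 * j) →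
      (lapL n ^ (j + a)) (rr n ^ a * f) = (c : ℂ) • (lapL n ^ j) f := by
  induction a with
  | zero => exact ⟨1, one_pos, fun f _ => by simp⟩
  | succ a ih =>
    obtain ⟨c, hc, h⟩ := ih
    obtain ⟨c', hc', h'⟩ := lapL_top_rr hn (j + a)
    refine ⟨c' * c, by positivity, fun f hf => ?_⟩
    have : rr n ^ (a + 1) * f = rr n * (rr n ^ a * f) := by ring
    rw [← add_assoc, this, h', h f hf, smul_smul]
    · push_cast; rfl
    · rw [show 2 * (j + a) = 2 * a + 2 * j by ring]
      exact ((rr_hom n).pow a).mul hf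

/-- Coefficientwise conjugation. -/
def pconj {n : ℕ} (f : MvPolynomial (Fin n) ℂ) : MvPolynomial (Fin n) ℂ :=
  map (starRingEnd ℂ) f

lemma lapL_pconj {n : ℕ} (f : MvPolynomial (Fin n) ℂ) :
    lapL n (pconj f) = pconj (lapL n f) := by
  simp [lapL_apply, pconj, pderiv_map, map_sum]

lemma lapL_pos {n : ℕ} (k : ℕ) : ∀ f : MvPolynomial (Fin n) ℂ, f.IsHomogeneous k →
    lapL n f = 0 → ∃ r : ℝ, 0 ≤ r ∧ (lapL n ^ k) (f * pconj f) = C (r : ℂ) ∧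
      (r = 0 → f = 0) := by
  induction k with
  | zero =>
    intro f hf _
    obtain ⟨c, rfl⟩ := hom_zero_eq_C hf
    refine ⟨Complex.normSq c, Complex.normSq_nonneg _, ?_, ?_⟩
    · rw [lapL_pow_zero, pconj, map_C, ← C_mul, Complex.mul_conj]
    · intro h
      rw [Complex.normSq_eq_zero] at h
      simp [h]
  | succ k ih =>
    intro f hf h0
    have hd : ∀ i : Fin n, ∃ r : ℝ, 0 ≤ r ∧
        (lapL n ^ k) (pderiv i f * pconj (pderiv i f)) = C (r : ℂ) ∧
        (r = 0 → pderiv i f = 0) := fun i => ih _ hf.pderiv (by rw [lapL_pderiv, h0, map_zero])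
    choose r hr0 hr1 hr2 using hd
    refine ⟨2 * ∑ i, r i, by have := Finset.sum_nonneg fun i (_ : i ∈ Finset.univ) => hr0 i
                             positivity, ?_, ?_⟩
    · have h3 : (2 : MvPolynomial (Fin n) ℂ) = C 2 := rfl
      rw [lapL_pow_succ, lapL_mul, lapL_pconj, h0]
      have : ∀ i, pderiv i (pconj f) = pconj (pderiv i f) := fun i => by simp [pconj, pderiv_map]
      simp only [this]
      rw [h3, ← smul_eq_C_mul]
      simp only [map_add, map_smul, map_sum, hr1]
      rw [smul_eq_C_mul]
      simp [pconj, map_sum]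
    · intro h
      have hs : ∑ i, r i = 0 := by linarith
      rw [Finset.sum_eq_zero_iff_of_nonneg (fun i _ => hr0 i)] at hs
      have h1 : ∀ i, pderiv i f = 0 := fun i => hr2 i (hs i (Finset.mem_univ _))
      have := hf.sum_X_mul_pderiv
      simp only [h1, mul_zero, Finset.sum_const_zero] at this
      have h2 := this.symm
      rw [smul_eq_zero] at h2
      rcases h2 with h2 | h2
      · omega
      · exact h2

lemma nondeg {n : ℕ} (hn : 0 < n) (e : ℕ) : ∀ f : MvPolynomial (Fin n) ℂ, f.IsHomogeneous e →
    (∀ g : MvPolynomial (Fin n) ℂ, g.IsHomogeneous e → (lapL n ^ e) (f * g) = 0) → f = 0 := by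
  induction e using Nat.strong_induction_on with
  | _ e ih =>
    intro f hf h
    by_cases he : e < 2
    · obtain ⟨r, _, hr1, hr2⟩ := lapL_pos e f hf (lapL_small he hf)
      rw [h (pconj f) (hf.map _)] at hr1
      apply hr2
      have := C_injective _ _ (hr1.symm.trans C_0.symm)
      exact_mod_cast this
    obtain ⟨e, rfl⟩ : ∃ e', e = e' + 2 := ⟨e - 2, by omega⟩
    obtain ⟨u, w, hu, hw, hw0, -, rfl⟩ := gauss_step hn _ e f hf (lapL_pow_hom hf)
    have hpw : (pconj w).IsHomogeneous (e + 2) := hw.map _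
    have hw00 : w = 0 := by
      have h1 := h (pconj w) hpw
      obtain ⟨c, hc, hc'⟩ := lapL_top_rr hn (e + 1)
      rw [add_mul, map_add, mul_assoc, hc' (u * pconj w)
        (by rw [show 2 * (e + 1) = e + (e + 2) by ring]; exact hu.mul hpw),
        lapL_pow_mul_eq_zero (e + 1) 1 e (pconj w) u (by omega)
          (by rw [pow_one, lapL_pconj, hw0]; simp [pconj]) hu] at h1
      obtain ⟨r, _, hr1, hr2⟩ := lapL_pos _ w hw hw0
      rw [smul_zero, zero_add, hr1] at h1
      apply hr2
      have := C_injective _ _ (h1.trans C_0.symm)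
      exact_mod_cast this
    subst hw00
    have hu00 : u = 0 := by
      refine ih e (by omega) u hu fun g hg => ?_
      have h1 := h (rr n * g) (by rw [add_comm]; exact (rr_hom n).mul hg)
      obtain ⟨c, hc, hc'⟩ := lapL_top_rr_pow hn 2 e
      have h2 : (rr n * u + 0) * (rr n * g) = rr n ^ 2 * (u * g) := by ring
      rw [h2, hc' _ (by rw [two_mul]; exact hu.mul hg), smul_eq_zero] at h1
      rcases h1 with h1 | h1
      · exact absurd (by exact_mod_cast h1) hc.ne'
      · exact h1
    rw [hu00]; simp

lemma comp_lapL {n : ℕ} (e : ℕ) (f : MvPolynomial (Fin n) ℂ) :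
    homogeneousComponent e (lapL n f) = lapL n (homogeneousComponent (e + 2) f) := by
  induction f using MvPolynomial.induction_on' with
  | monomial u a =>
    have hm : (monomial u a : MvPolynomial (Fin n) ℂ).IsHomogeneous u.degree :=
      isHomogeneous_monomial a rfl
    rw [homogeneousComponent_of_mem hm]
    by_cases hu : u.degree < 2
    · rw [lapL_small hu hm, if_neg (by omega)]; simp
    · rw [homogeneousComponent_of_mem (lapL_hom hm)]
      split_ifs with h1 h2 h2
      · rfl
      · omega
      · omega
      · simp
  | add p q hp hq => simp only [map_add, hp, hq]

lemma comp_lapL_pow {n : ℕ} (M : ℕ) : ∀ (e : ℕ) (f : MvPolynomial (Fin n) ℂ),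
    homogeneousComponent e ((lapL n ^ M) f) =
      (lapL n ^ M) (homogeneousComponent (e + 2 * M) f) := by
  induction M with
  | zero => intro e f; simp
  | succ M ih =>
    intro e f
    rw [lapL_pow_succ, ih, comp_lapL, lapL_pow_succ]
    rfl

lemma lapL_pow_small {n : ℕ} (M : ℕ) : ∀ (e : ℕ) (f : MvPolynomial (Fin n) ℂ), e < 2 * M →
    f.IsHomogeneous e → (lapL n ^ M) f = 0 := by
  induction M with
  | zero => intro e f h; omega
  | succ M ih =>
    intro e f h hf
    rw [lapL_pow_succ]
    by_cases he : e < 2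
    · rw [lapL_small he hf, map_zero]
    · exact ih (e - 2) _ (by omega) (lapL_hom hf)

lemma lapL_pow_comp {n M : ℕ} (e : ℕ) {f : MvPolynomial (Fin n) ℂ} (hf : (lapL n ^ M) f = 0) :
    (lapL n ^ M) (homogeneousComponent e f) = 0 := by
  by_cases h : e < 2 * M
  · exact lapL_pow_small M e _ h (homogeneousComponent_isHomogeneous _ _)
  · obtain ⟨c, rfl⟩ : ∃ c, e = c + 2 * M := ⟨e - 2 * M, by omega⟩
    rw [← comp_lapL_pow, hf, map_zero]

lemma top_split {n : ℕ} (P : MvPolynomial (Fin n) ℂ) :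
    P = ∑ i ∈ Finset.range P.totalDegree, homogeneousComponent i P
      + homogeneousComponent P.totalDegree P := by
  rw [← Finset.sum_range_succ, sum_homogeneousComponent]

lemma comp_top_mul {n k : ℕ} (P h : MvPolynomial (Fin n) ℂ) (hh : h.IsHomogeneous k) :
    homogeneousComponent (P.totalDegree + k) (P * h) =
      homogeneousComponent P.totalDegree P * h := by
  have hs : P * h = ∑ i ∈ Finset.range P.totalDegree, homogeneousComponent i P * h
      + homogeneousComponent P.totalDegree P * h := by
    rw [← Finset.sum_mul, ← add_mul, ← top_split]
  rw [hs, map_add, map_sum, Finset.sum_eq_zero, zero_add]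
  · exact homogeneousComponent_eq_self
      ((homogeneousComponent_isHomogeneous _ _).mul hh)
  · intro i hi
    rw [Finset.mem_range] at hi
    rw [homogeneousComponent_of_mem ((homogeneousComponent_isHomogeneous i P).mul hh),
      if_neg (by omega)]

lemma comp_top_ne_zero {n : ℕ} (P : MvPolynomial (Fin n) ℂ) (hP : P ≠ 0) :
    homogeneousComponent P.totalDegree P ≠ 0 := by
  intro h
  obtain ⟨s, hs, hs'⟩ := Finset.exists_mem_eq_sup P.support (support_nonempty.2 hP)
    (fun s => s.sum fun _ e => e)
  have h1 := coeff_homogeneousComponent P.totalDegree P s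
  rw [h, coeff_zero, if_pos] at h1
  · exact (mem_support_iff.1 hs) h1.symm
  · rw [MvPolynomial.totalDegree, hs', Finsupp.degree_eq_sum, Finsupp.sum_fintype]
    simp

/-- Representing a functional on homogeneous polynomials of degree `m`. -/
lemma exists_repr {n : ℕ} (hn : 0 < n) (m : ℕ) (L : MvPolynomial (Fin n) ℂ →ₗ[ℂ] ℂ) :
    ∃ q : MvPolynomial (Fin n) ℂ, q.IsHomogeneous m ∧
      ∀ f : MvPolynomial (Fin n) ℂ, f.IsHomogeneous m →
        (lapL n ^ m) (f * q) = C (L f) := by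
  let A := homogeneousSubmodule (Fin n) ℂ m
  have : FiniteDimensional ℂ A := Module.Finite.iff_fg.2 (homogeneousSubmodule_fg _ _ m)
  let B : A →ₗ[ℂ] Module.Dual ℂ A :=
    LinearMap.mk₂ ℂ (fun q f => coeff 0 ((lapL n ^ m) ((f : MvPolynomial (Fin n) ℂ) * q)))
      (by intro a b c; simp [mul_add]) (by intro a b c; simp)
      (by intro a b c; simp [add_mul]) (by intro a b c; simp)
  have hconst : ∀ f g : MvPolynomial (Fin n) ℂ, f.IsHomogeneous m → g.IsHomogeneous m →
      (lapL n ^ m) (f * g) = C (coeff 0 ((lapL n ^ m) (f * g))) := by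
    intro f g hf hg
    have h1 := comp_lapL_pow m 0 (f * g)
    rw [homogeneousComponent_zero] at h1
    rw [h1, homogeneousComponent_eq_self]
    rw [zero_add, two_mul]
    exact hf.mul hg
  have hinj : Function.Injective B := by
    rw [← LinearMap.ker_eq_bot, LinearMap.ker_eq_bot']
    intro q hq
    apply Subtype.ext
    refine nondeg hn m q q.2 fun g hg => ?_
    rw [hconst _ _ q.2 hg]
    have := LinearMap.congr_fun hq ⟨g, hg⟩
    simp only [B, LinearMap.mk₂_apply, LinearMap.zero_apply] at this
    rw [mul_comm, this, C_0]
  have hsurj : Function.Surjective B :=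
    (LinearMap.injective_iff_surjective_of_finrank_eq_finrank
      (Subspace.dual_finrank_eq).symm).1 hinj
  obtain ⟨q, hq⟩ := hsurj (L ∘ₗ A.subtype)
  refine ⟨q, q.2, fun f hf => ?_⟩
  rw [hconst _ _ hf q.2]
  have := LinearMap.congr_fun hq ⟨f, hf⟩
  simp only [B, LinearMap.mk₂_apply] at this
  rw [this]; rfl

lemma core {n : ℕ} (hn : 0 < n) (P : MvPolynomial (Fin n) ℂ) (hP : P ≠ 0) (N : ℕ)
    (hN : ∀ h : MvPolynomial (Fin n) ℂ, lapL n h = 0 → (lapL n ^ (N + 1)) (P * h) = 0)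
    (L : MvPolynomial (Fin n) ℂ →ₗ[ℂ] ℂ) (hLP : ∀ g, L (P * g) = 0)
    (hLN : ∀ Q, (lapL n ^ N) Q = 0 → L Q = 0) (f : MvPolynomial (Fin n) ℂ) : L f = 0 := by
  have key : ∀ m : ℕ, ∀ f : MvPolynomial (Fin n) ℂ, f.IsHomogeneous m → L f = 0 := by
    intro m
    induction m using Nat.strong_induction_on with
    | _ m ihm =>
    obtain ⟨q, hq, hqL⟩ := exists_repr hn m L
    set d := P.totalDegree with hd
    set T := homogeneousComponent d P with hT
    have hTh : T.IsHomogeneous d := homogeneousComponent_isHomogeneous _ _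
    have hT0 : T ≠ 0 := comp_top_ne_zero P hP
    -- harmonic case
    have hharm : ∀ (k j : ℕ) (h : MvPolynomial (Fin n) ℂ), d + k + m = 2 * j →
        h.IsHomogeneous k → lapL n h = 0 → (lapL n ^ j) (T * h * q) = 0 := by
      intro k j h hj hh h0
      have hTH : (T * h).IsHomogeneous (d + k) := hTh.mul hh
      by_cases hle : d + k ≤ m
      · obtain ⟨a, ha⟩ : ∃ a, m = d + k + 2 * a := ⟨j - (d + k), by omega⟩
        have hL : L (rr n ^ a * (T * h)) = 0 := by
          have h1 := hLP (rr n ^ a * h)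
          rw [top_split P, add_mul, Finset.sum_mul, map_add, map_sum, Finset.sum_eq_zero,
            zero_add] at h1
          · rw [← h1]; congr 1; rw [← hd, ← hT]; ring
          · intro i hi
            rw [Finset.mem_range] at hi
            exact ihm (i + (2 * a + k)) (by omega) _
              ((homogeneousComponent_isHomogeneous _ _).mul (((rr_hom n).pow a).mul hh))
        have h2 := hqL (rr n ^ a * (T * h)) (by
          rw [ha, add_comm]; exact ((rr_hom n).pow a).mul hTH)
        obtain ⟨c, hc, hc'⟩ := lapL_top_rr_pow hn a j
        rw [hL, C_0, mul_assoc, show m = j + a by omega, hc' _ (by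
          rw [← hj]; exact hTH.mul hq), smul_eq_zero] at h2
        rcases h2 with h2 | h2
        · exact absurd (by exact_mod_cast h2) hc.ne'
        · exact h2
      · obtain ⟨b, hb⟩ : ∃ b, d + k = m + 2 * b := ⟨j - m, by omega⟩
        have hM : (lapL n ^ (N + 1)) (T * h) = 0 := by
          rw [hT, ← comp_top_mul P h hh]
          exact lapL_pow_comp _ (hN h h0)
        obtain ⟨u, w, hu, hw, hw0, hu0, he⟩ := gauss_iter hn b (N + 1) m (T * h)
          (by rw [← hb]; exact hTH) hM
        have hLu : L u = 0 := hLN u (lapL_pow_mono (by omega) hu0)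
        have h2 := hqL u hu
        rw [hLu, C_0] at h2
        obtain ⟨c, hc, hc'⟩ := lapL_top_rr_pow hn b m
        rw [he, add_mul, map_add, mul_assoc, show j = m + b by omega,
          hc' _ (by rw [two_mul]; exact hu.mul hq), h2, smul_zero, zero_add, mul_comm w q]
        exact lapL_pow_mul_eq_zero _ b m w q (by omega) hw0 hq
    have hall : ∀ (k j : ℕ) (g : MvPolynomial (Fin n) ℂ), d + k + m = 2 * j →
        g.IsHomogeneous k → (lapL n ^ j) (T * g * q) = 0 := by
      intro k
      induction k using Nat.strong_induction_on with
      | _ k ihk =>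
      intro j g hj hg
      by_cases hk : k < 2
      · exact hharm k j g hj hg (lapL_small hk hg)
      obtain ⟨k, rfl⟩ : ∃ k', k = k' + 2 := ⟨k - 2, by omega⟩
      obtain ⟨u, w, hu, hw, hw0, -, rfl⟩ := gauss_step hn _ k g hg (lapL_pow_hom hg)
      obtain ⟨j, rfl⟩ : ∃ j', j = j' + 1 := ⟨j - 1, by omega⟩
      obtain ⟨c, hc, hc'⟩ := lapL_top_rr hn j
      have e1 : T * (rr n * u + w) * q = rr n * (T * u * q) + T * w * q := by ring
      rw [e1, map_add, hharm _ _ w hj hw hw0, hc' _ (by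
        rw [show 2 * j = d + k + m by omega]; exact (hTh.mul hu).mul hq),
        ihk k (by omega) j u (by omega) hu]
      simp
    have hTq : T * q = 0 := by
      refine nondeg hn (d + m) _ (hTh.mul hq) fun g hg => ?_
      rw [show T * q * g = T * g * q by ring]
      exact hall (d + m) (d + m) g (by ring) hg
    have hq0 : q = 0 := (mul_eq_zero.1 hTq).resolve_left hT0
    intro f hf
    have := hqL f hf
    rw [hq0, mul_zero, map_zero] at this
    exact C_injective _ _ (this.symm.trans C_0.symm)
  rw [← sum_homogeneousComponent f, map_sum]
  exact Finset.sum_eq_zero fun i _ => key i _ (homogeneousComponent_isHomogeneous _ _)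

lemma pdeg_bound {n : ℕ} (P : MvPolynomial (Fin n) ℂ) (N : ℕ)
    (hN : N = sSup {d : ℕ | ∃ h : MvPolynomial (Fin n) ℂ,
      IsHarmonicPoly n h ∧ pdeg n (P * h) = d})
    (h : MvPolynomial (Fin n) ℂ) (hh : lapL n h = 0) : (lapL n ^ (N + 1)) (P * h) = 0 := by
  have hb : ∀ h : MvPolynomial (Fin n) ℂ, lapL n h = 0 →
      (lapL n ^ (P.totalDegree + 1)) (P * h) = 0 := by
    intro h hh
    have hs : P * h = ∑ i ∈ Finset.range (P.totalDegree + 1), homogeneousComponent i P * h := by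
      rw [← Finset.sum_mul, sum_homogeneousComponent]
    rw [hs, map_sum]
    refine Finset.sum_eq_zero fun i hi => ?_
    rw [Finset.mem_range] at hi
    exact lapL_pow_mul_eq_zero _ 1 i _ _ (by omega) (by rw [pow_one, hh])
      (homogeneousComponent_isHomogeneous _ _)
  have hle : pdeg n (P * h) ≤ N := by
    rw [hN]
    refine le_csSup ⟨P.totalDegree, ?_⟩ ⟨h, hh, rfl⟩
    rintro d ⟨g, hg, rfl⟩
    refine Nat.sInf_le ?_
    change (lap n)^[P.totalDegree + 1] (P * g) = 0
    rw [← lapL_pow]; exact hb g hg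
  have hmem : (lap n)^[pdeg n (P * h) + 1] (P * h) = 0 := by
    refine Nat.sInf_mem (s := {N : ℕ | (lap n)^[N + 1] (P * h) = 0}) ⟨P.totalDegree, ?_⟩
    change (lap n)^[P.totalDegree + 1] (P * h) = 0
    rw [← lapL_pow]; exact hb h hh
  rw [← lapL_pow] at hmem
  exact lapL_pow_mono (by omega) hmem

lemma evalR_continuous {n : ℕ} (Q : MvPolynomial (Fin n) ℂ) :
    Continuous (fun x : En n => evalR Q x) := by
  unfold evalR
  refine (MvPolynomial.continuous_eval Q).comp ?_
  fun_prop

lemma evalR_integrable {n : ℕ} (μ : Measure (En n)) [IsFiniteMeasure μ] (R : ℝ)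
    (hμ : ∀ᵐ x ∂μ, ‖x‖ ≤ R) (Q : MvPolynomial (Fin n) ℂ) :
    Integrable (fun x : En n => evalR Q x) μ := by
  obtain ⟨c, hc⟩ := (isCompact_closedBall (0 : En n) R).exists_bound_of_continuousOn
    (evalR_continuous Q).continuousOn
  refine Integrable.of_bound (evalR_continuous Q).aestronglyMeasurable c ?_
  filter_upwards [hμ] with x hx
  exact hc x (by simpa using hx)

/-- The polynomial `⟨x, t⟩`. -/
def linP {n : ℕ} (t : En n) : MvPolynomial (Fin n) ℂ := ∑ i, C ((t i : ℝ) : ℂ) * X i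

lemma evalR_linP {n : ℕ} (t x : En n) : evalR (linP t) x = ((inner ℝ x t : ℝ) : ℂ) := by
  simp [evalR, linP, PiLp.inner_apply]

lemma charFun_hasSum {n : ℕ} (μ : Measure (En n)) [IsFiniteMeasure μ] (R : ℝ)
    (hμ : ∀ᵐ x ∂μ, ‖x‖ ≤ R) (t : En n) :
    HasSum (fun k : ℕ => Complex.I ^ k / (k.factorial : ℂ) * ∫ x, evalR (linP t ^ k) x ∂μ)
      (charFun μ t) := by
  rw [charFun_apply]
  simp_rw [← integral_const_mul]
  refine hasSum_integral_of_dominated_convergence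
    (fun k _ => (R * ‖t‖) ^ k / (k.factorial : ℝ)) ?_ ?_ ?_ ?_ ?_
  · intro k
    exact ((evalR_continuous _).const_mul _).aestronglyMeasurable
  · intro k
    filter_upwards [hμ] with x hx
    have h1 : evalR (linP t ^ k) x = ((inner ℝ x t : ℝ) : ℂ) ^ k := by
      rw [← evalR_linP]; simp [evalR]
    rw [h1]
    simp only [norm_mul, norm_div, norm_pow, Complex.norm_I, one_pow, Complex.norm_natCast,
      Complex.norm_real]
    rw [div_mul_eq_mul_div, one_mul]
    gcongr
    exact (norm_inner_le_norm x t).trans (by gcongr)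
  · exact Filter.Eventually.of_forall fun _ => Real.summable_pow_div_factorial _
  · exact integrable_const _
  · refine Filter.Eventually.of_forall fun x => ?_
    have h1 : ∀ k : ℕ, evalR (linP t ^ k) x = ((inner ℝ x t : ℝ) : ℂ) ^ k := by
      intro k
      rw [← evalR_linP]; simp [evalR]
    simp only [h1]
    have := NormedSpace.expSeries_div_hasSum_exp (𝔸 := ℂ) (((inner ℝ x t : ℝ) : ℂ) * Complex.I)
    rw [← Complex.exp_eq_exp_ℂ] at this
    have e : (fun k : ℕ => Complex.I ^ k / (k.factorial : ℂ) * ((inner ℝ x t : ℝ) : ℂ) ^ k) =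
        fun k : ℕ => (((inner ℝ x t : ℝ) : ℂ) * Complex.I) ^ k / (k.factorial : ℂ) := by
      funext k
      rw [mul_pow]; ring
    rw [e]
    exact this

lemma measure_ext_of_poly {n : ℕ} (μ ν : Measure (En n)) [IsFiniteMeasure μ] [IsFiniteMeasure ν]
    (R : ℝ) (hμ : ∀ᵐ x ∂μ, ‖x‖ ≤ R) (hν : ∀ᵐ x ∂ν, ‖x‖ ≤ R)
    (h : ∀ Q : MvPolynomial (Fin n) ℂ, ∫ x, evalR Q x ∂μ = ∫ x, evalR Q x ∂ν) : μ = ν := by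
  apply Measure.ext_of_charFun
  ext t
  refine (charFun_hasSum μ R hμ t).unique ?_
  simp_rw [h]
  exact charFun_hasSum ν R hν t

/-- Two finite nonnegative measures supported in
`K_P(R) = {x : P x = 0, |x| ≤ R}` coincide iff they agree on all polynomials `Q`
with `Δ^{N_P} Q = 0`, where `N_P = sup {d(P·h) : h harmonic}`. -/
theorem measure_eq_iff_integral_polyharmonic_eq
    (n : ℕ) (hn : 2 ≤ n) (P : MvPolynomial (Fin n) ℂ) (hP : P ≠ 0)
    (NP : ℕ)
    (hNP : NP = sSup {d : ℕ | ∃ h : MvPolynomial (Fin n) ℂ,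
      IsHarmonicPoly n h ∧ pdeg n (P * h) = d})
    (R : ℝ) (hR : 0 < R)
    (μ ν : Measure (En n)) [IsFiniteMeasure μ] [IsFiniteMeasure ν]
    (hμ : μ {x : En n | ¬ (evalR P x = 0 ∧ ‖x‖ ≤ R)} = 0)
    (hν : ν {x : En n | ¬ (evalR P x = 0 ∧ ‖x‖ ≤ R)} = 0) :
    μ = ν ↔ ∀ Q : MvPolynomial (Fin n) ℂ, (lap n)^[NP] Q = 0 →
      ∫ x, evalR Q x ∂μ = ∫ x, evalR Q x ∂ν := by
  constructor
  · rintro rfl Q _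
    rfl
  intro h
  have aμ : ∀ᵐ x ∂μ, evalR P x = 0 ∧ ‖x‖ ≤ R := hμ
  have aν : ∀ᵐ x ∂ν, evalR P x = 0 ∧ ‖x‖ ≤ R := hν
  have bμ : ∀ᵐ x ∂μ, ‖x‖ ≤ R := aμ.mono fun _ hx => hx.2
  have bν : ∀ᵐ x ∂ν, ‖x‖ ≤ R := aν.mono fun _ hx => hx.2
  let L : MvPolynomial (Fin n) ℂ →ₗ[ℂ] ℂ :=
    { toFun := fun Q => ∫ x, evalR Q x ∂μ - ∫ x, evalR Q x ∂ν
      map_add' := by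
        intro f g
        have e : ∀ x : En n, evalR (f + g) x = evalR f x + evalR g x := by
          intro x; simp [evalR]
        simp only [e]
        rw [integral_add (evalR_integrable μ R bμ f) (evalR_integrable μ R bμ g),
          integral_add (evalR_integrable ν R bν f) (evalR_integrable ν R bν g)]
        ring
      map_smul' := by
        intro c f
        have e : ∀ x : En n, evalR (c • f) x = c * evalR f x := by
          intro x; simp [evalR, smul_eval]
        simp only [e]
        rw [integral_const_mul, integral_const_mul]
        simp [mul_sub] }
  refine measure_ext_of_poly μ ν R bμ bν fun Q => ?_
  have hL : L Q = 0 := by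
    refine core (by omega) P hP NP (pdeg_bound P NP hNP) L ?_ ?_ Q
    · intro g
      have e : ∀ x : En n, evalR (P * g) x = evalR P x * evalR g x := by
        intro x; simp [evalR]
      change ∫ x, evalR (P * g) x ∂μ - ∫ x, evalR (P * g) x ∂ν = 0
      rw [integral_eq_zero_of_ae, integral_eq_zero_of_ae, sub_zero]
      · filter_upwards [aν] with x hx
        simp [e, hx.1]
      · filter_upwards [aμ] with x hx
        simp [e, hx.1]
    · intro Q hQ
      rw [lapL_pow] at hQ
      exact sub_eq_zero.2 (h Q hQ)
  exact sub_eq_zero.1 hL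
end
end

section
/- Let n ≥ 2, let P be a nonzero polynomial on ℝⁿ, set N_P := sup{d(P·h) : h a harmonic polynomial on ℝⁿ}, and let R > 0. Then the space U_{N_P} := {Q polynomial on ℝⁿ : Δ^{N_P}Q = 0}, regarded as a subspace of functions on K_P(R) by restriction, is dense in the space C(K_P(R), ℂ) of continuous complex-valued functions on the compact set K_P(R) endowed with the supremum norm. -/
open MeasureTheory Metric MvPolynomial

noncomputable section

namespace PH

/-- The Laplacian as a linear map. -/
def lapL (n : ℕ) : MvPolynomial (Fin n) ℂ →ₗ[ℂ] MvPolynomial (Fin n) ℂ :=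
  ∑ i : Fin n, (pderiv i).toLinearMap ∘ₗ (pderiv i).toLinearMap

lemma lapL_apply (n : ℕ) (f : MvPolynomial (Fin n) ℂ) : lapL n f = lap n f := by
  simp [lapL, lap]

lemma lap_eq (n : ℕ) : lap n = ⇑(lapL n) := by
  funext f; rw [lapL_apply]

lemma lap_iter (n k : ℕ) (f : MvPolynomial (Fin n) ℂ) : (lap n)^[k] f = (lapL n ^ k) f := by
  rw [lap_eq, Module.End.pow_apply]

lemma pderiv_comm' {n : ℕ} (i j : Fin n) (f : MvPolynomial (Fin n) ℂ) :
    pderiv i (pderiv j f) = pderiv j (pderiv i f) := by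
  have h : ⁅pderiv (R := ℂ) i, pderiv (R := ℂ) j⁆ = 0 := by
    apply MvPolynomial.derivation_ext
    intro k
    rw [Derivation.commutator_apply]
    by_cases h1 : k = i <;> by_cases h2 : k = j <;> simp [pderiv_X, Pi.single_apply, h1, h2] <;>
      split_ifs <;> simp
  have := congrArg (fun D => D f) h
  simp only [Derivation.commutator_apply, Derivation.coe_zero, Pi.zero_apply] at this
  exact sub_eq_zero.mp this

lemma pow_succ_app {M : Type*} [AddCommGroup M] [Module ℂ M] (T : M →ₗ[ℂ] M) (k : ℕ) (f : M) :
    (T ^ (k + 1)) f = (T ^ k) (T f) := by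
  rw [pow_succ]; rfl

lemma pow_succ_app' {M : Type*} [AddCommGroup M] [Module ℂ M] (T : M →ₗ[ℂ] M) (k : ℕ) (f : M) :
    (T ^ (k + 1)) f = T ((T ^ k) f) := by
  rw [pow_succ']; rfl

lemma pow_zero_of_le {M : Type*} [AddCommGroup M] [Module ℂ M] (T : M →ₗ[ℂ] M) {k l : ℕ}
    (h : k ≤ l) {f : M} (hf : (T ^ k) f = 0) : (T ^ l) f = 0 := by
  obtain ⟨c, rfl⟩ := Nat.exists_eq_add_of_le' h
  rw [pow_add, Module.End.mul_apply, hf, map_zero]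

/-- product rule -/
lemma lapL_mul {n : ℕ} (f g : MvPolynomial (Fin n) ℂ) :
    lapL n (f * g) = lapL n f * g + 2 * ∑ i, pderiv i f * pderiv i g + f * lapL n g := by
  simp only [lapL_apply, lap, pderiv_mul, map_add, Finset.sum_add_distrib, Finset.sum_mul,
    Finset.mul_sum]
  simp only [← Finset.sum_add_distrib]
  refine Finset.sum_congr rfl fun i _ => ?_
  ring

lemma lapL_pderiv {n : ℕ} (i : Fin n) (f : MvPolynomial (Fin n) ℂ) :
    lapL n (pderiv i f) = pderiv i (lapL n f) := by
  simp only [lapL_apply, lap, map_sum]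
  refine Finset.sum_congr rfl fun j _ => ?_
  rw [pderiv_comm' j i f, pderiv_comm' j i]

def rho (n : ℕ) : MvPolynomial (Fin n) ℂ := ∑ i, X i ^ 2

def eul {n : ℕ} (f : MvPolynomial (Fin n) ℂ) : MvPolynomial (Fin n) ℂ := ∑ i, X i * pderiv i f

lemma pderiv_rho {n : ℕ} (i : Fin n) : pderiv i (rho n) = 2 * X i := by
  simp only [rho, map_sum, pderiv_pow]
  rw [Finset.sum_eq_single i]
  · simp
  · intro j _ h; simp [pderiv_X_of_ne h]
  · simp

lemma lapL_rho {n : ℕ} : lapL n (rho n) = C (2 * n : ℂ) := by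
  simp only [lapL_apply, lap, pderiv_rho, pderiv_mul]
  have : (2 : MvPolynomial (Fin n) ℂ) = C 2 := (map_ofNat C 2).symm
  simp [this]; ring

lemma lapL_rho_mul {n : ℕ} (f : MvPolynomial (Fin n) ℂ) :
    lapL n (rho n * f) = rho n * lapL n f + (2 * n : ℂ) • f + (4 : ℂ) • eul f := by
  rw [lapL_mul, lapL_rho]
  simp only [pderiv_rho, eul, smul_eq_C_mul, Finset.mul_sum]
  have : (C 4 : MvPolynomial (Fin n) ℂ) = 4 := map_ofNat C 4
  have h : ∀ i : Fin n, 2 * (2 * X i * pderiv i f) = C 4 * (X i * pderiv i f) := by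
    intro i; rw [this]; ring
  simp only [h]; ring

lemma lapL_eul {n : ℕ} (f : MvPolynomial (Fin n) ℂ) :
    lapL n (eul f) = eul (lapL n f) + (2 : ℂ) • lapL n f := by
  have h : ∀ i : Fin n, lapL n (X i * pderiv i f)
      = X i * pderiv i (lapL n f) + (2 : ℂ) • pderiv i (pderiv i f) := by
    intro i
    rw [lapL_mul, lapL_pderiv]
    have h1 : lapL n (X i : MvPolynomial (Fin n) ℂ) = 0 := by
      simp only [lapL_apply, lap]
      refine Finset.sum_eq_zero fun j _ => ?_
      rw [pderiv_X]; simp only [Pi.single_apply]; split_ifs <;> simp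
    have h2 : ∑ j, pderiv j (X i : MvPolynomial (Fin n) ℂ) * pderiv j (pderiv i f)
        = pderiv i (pderiv i f) := by
      rw [Finset.sum_eq_single i]
      · simp
      · intro j _ hj; simp [pderiv_X_of_ne (Ne.symm hj)]
      · simp
    rw [h1, h2, smul_eq_C_mul, map_ofNat C 2]; ring
  simp only [eul, map_sum, h, Finset.sum_add_distrib, ← Finset.smul_sum]
  simp [lapL_apply, lap]

lemma pow_eul_zero {n : ℕ} (N : ℕ) : ∀ f : MvPolynomial (Fin n) ℂ,
    (lapL n ^ N) f = 0 → (lapL n ^ N) (eul f) = 0 := by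
  induction N with
  | zero => intro f hf; simp at hf; subst hf; simp [eul]
  | succ N ih =>
    intro f hf
    rw [pow_succ_app] at hf ⊢
    rw [lapL_eul, map_add, map_smul, ih _ hf, hf]; simp

lemma pow_rho_zero {n : ℕ} (N : ℕ) : ∀ f : MvPolynomial (Fin n) ℂ,
    (lapL n ^ N) f = 0 → (lapL n ^ (N + 1)) (rho n * f) = 0 := by
  induction N with
  | zero => intro f hf; simp at hf; subst hf; simp
  | succ N ih =>
    intro f hf
    rw [pow_succ_app, lapL_rho_mul, map_add, map_add, map_smul, map_smul, pow_eul_zero _ _ hf, hf]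
    rw [pow_succ_app] at hf
    rw [ih _ hf]; simp

lemma eul_homog {n d : ℕ} {f : MvPolynomial (Fin n) ℂ} (hf : f.IsHomogeneous d) :
    eul f = (d : ℂ) • f := by
  rw [eul, hf.sum_X_mul_pderiv, Nat.cast_smul_eq_nsmul]

lemma lapL_homog {n d : ℕ} {f : MvPolynomial (Fin n) ℂ} (hf : f.IsHomogeneous d) :
    (lapL n f).IsHomogeneous (d - 2) := by
  rw [lapL_apply]
  exact IsHomogeneous.sum _ _ _ fun i _ => hf.pderiv.pderiv

lemma lapL_low {n d : ℕ} {f : MvPolynomial (Fin n) ℂ} (hf : f.IsHomogeneous d) (hd : d < 2) :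
    lapL n f = 0 := by
  rw [lapL_apply]
  refine Finset.sum_eq_zero fun i _ => ?_
  have h : (pderiv i f).IsHomogeneous 0 := by
    have := hf.pderiv (i := i)
    rwa [show d - 1 = 0 by omega] at this
  rw [← totalDegree_zero_iff_isHomogeneous, totalDegree_eq_zero_iff_eq_C] at h
  rw [h, pderiv_C]

lemma lapL_pow_homog {n d : ℕ} {f : MvPolynomial (Fin n) ℂ} (hf : f.IsHomogeneous d) (k : ℕ) :
    ((lapL n ^ k) f).IsHomogeneous (d - 2 * k) := by
  induction k with
  | zero => simpa using hf
  | succ k ih => rw [pow_succ_app']; rw [show d - 2 * (k + 1) = d - 2 * k - 2 by omega]; exact lapL_homog ih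

lemma lapL_pow_low {n d : ℕ} {f : MvPolynomial (Fin n) ℂ} (hf : f.IsHomogeneous d) {k : ℕ}
    (hk : d < 2 * k) : (lapL n ^ k) f = 0 := by
  obtain ⟨k, rfl⟩ : ∃ j, k = j + 1 := ⟨k - 1, by omega⟩
  rw [pow_succ_app']
  exact lapL_low (lapL_pow_homog hf k) (by omega)

lemma lapL_rho_homog {n d : ℕ} {f : MvPolynomial (Fin n) ℂ} (hf : f.IsHomogeneous d) :
    lapL n (rho n * f) = rho n * lapL n f + (2 * n + 4 * d : ℂ) • f := by
  rw [lapL_rho_mul, eul_homog hf, smul_smul, add_assoc, ← add_smul]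

lemma rho_homog (n : ℕ) : (rho n).IsHomogeneous 2 :=
  IsHomogeneous.sum _ _ _ fun i _ => isHomogeneous_X_pow i 2

lemma smul_homog {n d : ℕ} {f : MvPolynomial (Fin n) ℂ} (hf : f.IsHomogeneous d) (c : ℂ) :
    (c • f).IsHomogeneous d := by
  rw [smul_eq_C_mul]; exact hf.C_mul c

lemma descent {n : ℕ} (l : ℕ) : ∀ (c : ℝ), 0 < c → ∀ u : MvPolynomial (Fin n) ℂ,
    u.IsHomogeneous l → rho n * lapL n u = -((c : ℂ) • u) → u = 0 := by
  induction l using Nat.strong_induction_on with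
  | _ l ih =>
  intro c hc u hu h
  have hc' : (c : ℂ) ≠ 0 := by exact_mod_cast hc.ne'
  by_cases hl : l < 2
  · rw [lapL_low hu hl] at h
    simp at h
    exact h.resolve_left hc.ne'
  · set u1 := lapL n u with hu1
    have hu1h := lapL_homog hu
    rw [← hu1] at hu1h
    have e1 : (c : ℂ) • u1 = -(rho n * lapL n u1 + (2 * n + 4 * (l - 2 : ℕ) : ℂ) • u1) := by
      rw [← lapL_rho_homog hu1h, h, hu1]; simp
    have : u1 = 0 := by
      refine ih (l - 2) (by omega) (c + (2 * n + 4 * (l - 2 : ℕ))) (by positivity) u1 hu1h ?_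
      push_cast
      rw [add_smul, e1]; abel
    rw [this] at h
    simp at h
    exact h.resolve_left hc.ne'

lemma rho_formula {n e : ℕ} {g : MvPolynomial (Fin n) ℂ} (hg : g.IsHomogeneous e) (M : ℕ)
    (hM : 2 * M ≤ e) : (lapL n ^ (M + 1)) (rho n * g) = rho n * (lapL n ^ (M + 1)) g +
      ((M + 1) * (2 * n + 4 * e - 4 * M) : ℂ) • (lapL n ^ M) g := by
  induction M with
  | zero => simp [lapL_rho_homog hg]
  | succ M ih =>
    rw [pow_succ_app', ih (by omega), map_add, lapL_rho_homog (lapL_pow_homog hg (M + 1)),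
      ← pow_succ_app' (lapL n) (M + 1), map_smul, ← pow_succ_app' (lapL n) M, add_assoc, ← add_smul]
    congr 2
    rw [Nat.cast_sub hM]; push_cast; ring

lemma rho_inj {n e : ℕ} (hn : 0 < n) {g : MvPolynomial (Fin n) ℂ} (hg : g.IsHomogeneous e) (M : ℕ)
    (h : (lapL n ^ (M + 1)) (rho n * g) = 0) : (lapL n ^ M) g = 0 := by
  by_cases hM : 2 * M ≤ e
  · rw [rho_formula hg M hM] at h
    refine descent (e - 2 * M) ((M + 1) * (2 * n + 4 * e - 4 * M)) ?_ _ (lapL_pow_homog hg M) ?_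
    · have : (2 * M : ℝ) ≤ e := by exact_mod_cast hM
      have : (0 : ℝ) < n := by exact_mod_cast hn
      have : (0 : ℝ) ≤ M := by positivity
      apply mul_pos <;> linarith
    · rw [← pow_succ_app']
      push_cast
      exact eq_neg_of_add_eq_zero_left h
  · exact lapL_pow_low hg (by omega)

lemma ascent {n : ℕ} (l : ℕ) : ∀ (c : ℝ), 0 < c → ∀ f : MvPolynomial (Fin n) ℂ,
    f.IsHomogeneous l → ∃ v : MvPolynomial (Fin n) ℂ, v.IsHomogeneous l ∧
      rho n * lapL n v + (c : ℂ) • v = f := by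
  induction l using Nat.strong_induction_on with
  | _ l ih =>
  intro c hc f hf
  have hc' : (c : ℂ) ≠ 0 := by exact_mod_cast hc.ne'
  by_cases hl : l < 2
  · refine ⟨(c : ℂ)⁻¹ • f, smul_homog hf _, ?_⟩
    rw [map_smul, lapL_low hf hl, smul_smul, mul_inv_cancel₀ hc']; simp
  · obtain ⟨r, hr, e⟩ := ih (l - 2) (by omega) (c + (2 * n + 4 * (l - 2 : ℕ))) (by positivity)
      (lapL n f) (lapL_homog hf)
    have e2 : lapL n ((c : ℂ)⁻¹ • (f - rho n * r)) = r := by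
      rw [map_smul, map_sub, lapL_rho_homog hr, ← e, inv_smul_eq_iff₀ hc']
      push_cast
      rw [add_smul]; abel
    refine ⟨(c : ℂ)⁻¹ • (f - rho n * r), smul_homog (hf.sub ?_) _, ?_⟩
    · have := (rho_homog n).mul hr
      rwa [show 2 + (l - 2) = l by omega] at this
    · rw [e2, smul_smul, mul_inv_cancel₀ hc']; simp

/-- `P` is good for `N` : every polynomial is a multiple of `P` plus an `N`-polyharmonic one. -/
def goodSub {n : ℕ} (P : MvPolynomial (Fin n) ℂ) (N : ℕ) : Submodule ℂ (MvPolynomial (Fin n) ℂ) where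
  carrier := {f | ∃ q, (lapL n ^ N) (f - P * q) = 0}
  add_mem' := by
    rintro f g ⟨q, hq⟩ ⟨r, hr⟩
    refine ⟨q + r, ?_⟩
    rw [mul_add, add_sub_add_comm, map_add, hq, hr, add_zero]
  zero_mem' := ⟨0, by simp⟩
  smul_mem' := by
    rintro c f ⟨q, hq⟩
    refine ⟨c • q, ?_⟩
    rw [mul_smul_comm, ← smul_sub, map_smul, hq, smul_zero]

def Good {n : ℕ} (P : MvPolynomial (Fin n) ℂ) (N : ℕ) : Prop := ∀ f, f ∈ goodSub P N

lemma mem_goodSub {n : ℕ} {P : MvPolynomial (Fin n) ℂ} {N : ℕ} {f : MvPolynomial (Fin n) ℂ} :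
    f ∈ goodSub P N ↔ ∃ q, (lapL n ^ N) (f - P * q) = 0 := Iff.rfl

lemma good_of_homog {n : ℕ} {P : MvPolynomial (Fin n) ℂ} {N : ℕ}
    (h : ∀ d, ∀ f : MvPolynomial (Fin n) ℂ, f.IsHomogeneous d → f ∈ goodSub P N) : Good P N := by
  intro f
  rw [← sum_homogeneousComponent f]
  exact Submodule.sum_mem _ fun i _ => h i _ (homogeneousComponent_isHomogeneous i f)

lemma Good.mono {n : ℕ} {P : MvPolynomial (Fin n) ℂ} {N M : ℕ} (h : Good P N) (hNM : N ≤ M) :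
    Good P M := fun f => by
  obtain ⟨q, hq⟩ := h f
  exact ⟨q, pow_zero_of_le _ hNM hq⟩

lemma good_rho {n : ℕ} (hn : 0 < n) : Good (rho n) 1 := by
  apply good_of_homog
  intro d f hf
  obtain ⟨v, hv, e⟩ := ascent (n := n) (d - 2) (2 * n + 4 * (d - 2 : ℕ)) (by positivity) (lapL n f)
    (lapL_homog hf)
  refine ⟨v, ?_⟩
  rw [pow_one, map_sub, lapL_rho_homog hv, ← e]
  push_cast
  simp

lemma good_rho_mul {n : ℕ} (hn : 0 < n) {P : MvPolynomial (Fin n) ℂ} {N : ℕ} (h : Good P N) :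
    Good (rho n * P) (N + 1) := by
  intro f
  obtain ⟨g, hg⟩ := good_rho hn f
  obtain ⟨q, hq⟩ := h g
  refine ⟨q, ?_⟩
  have : f - rho n * P * q = (f - rho n * g) + rho n * (g - P * q) := by ring
  rw [this, map_add, pow_rho_zero _ _ hq, pow_zero_of_le _ (by omega) hg, add_zero]

end PH

namespace PH

/-! ### A weighted triangularity argument -/

section weights

variable {n : ℕ}

/-- weight of an exponent -/
def wt (v : Fin n → ℕ) (m : Fin n →₀ ℕ) : ℕ := ∑ i, v i * m i

lemma wt_add (v : Fin n → ℕ) (m m' : Fin n →₀ ℕ) : wt v (m + m') = wt v m + wt v m' := by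
  simp [wt, mul_add, Finset.sum_add_distrib]

lemma wt_single (v : Fin n → ℕ) (i : Fin n) (k : ℕ) : wt v (Finsupp.single i k) = v i * k := by
  classical
  rw [wt, Finset.sum_eq_single i]
  · simp
  · intro j _ hj; simp [hj.symm]
  · simp

/-- polynomials all of whose exponents have weight `< k` -/
def G (v : Fin n → ℕ) (k : ℕ) : Submodule ℂ (MvPolynomial (Fin n) ℂ) where
  carrier := {f | ∀ m, coeff m f ≠ 0 → wt v m < k}
  add_mem' := by
    intro f g hf hg m hm
    rw [coeff_add] at hm
    by_cases h : coeff m f = 0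
    · rw [h, zero_add] at hm; exact hg m hm
    · exact hf m h
  zero_mem' := by intro m hm; simp at hm
  smul_mem' := by
    intro c f hf m hm
    rw [coeff_smul, smul_eq_mul] at hm
    exact hf m (right_ne_zero_of_mul hm)

lemma mem_G {v : Fin n → ℕ} {k : ℕ} {f : MvPolynomial (Fin n) ℂ} :
    f ∈ G v k ↔ ∀ m, coeff m f ≠ 0 → wt v m < k := Iff.rfl

lemma G_mono {v : Fin n → ℕ} {k l : ℕ} (h : k ≤ l) : G v k ≤ G v l :=
  fun _ hf m hm => (hf m hm).trans_le h

lemma G_zero {v : Fin n → ℕ} {f : MvPolynomial (Fin n) ℂ} (hf : f ∈ G v 0) : f = 0 := by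
  ext m
  by_contra h
  exact absurd (hf m (by simpa using h)) (by omega)

lemma G_mul {v : Fin n → ℕ} {k l : ℕ} {f g : MvPolynomial (Fin n) ℂ} (hf : f ∈ G v k)
    (hg : g ∈ G v (l + 1)) : f * g ∈ G v (k + l) := by
  classical
  intro m hm
  rw [coeff_mul] at hm
  obtain ⟨x, hx, hne⟩ := Finset.exists_ne_zero_of_sum_ne_zero hm
  rw [Finset.HasAntidiagonal.mem_antidiagonal] at hx
  have h1 := hf _ (left_ne_zero_of_mul hne)
  have h2 := hg _ (right_ne_zero_of_mul hne)
  rw [← hx, wt_add]; omega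

lemma G_monomial {v : Fin n → ℕ} {k : ℕ} {m : Fin n →₀ ℕ} (h : wt v m < k) (c : ℂ) :
    monomial m c ∈ G v k := by
  classical
  intro m' hm'
  rw [coeff_monomial] at hm'
  split_ifs at hm' with e
  · rwa [← e]
  · exact absurd rfl hm'

lemma G_pderiv {v : Fin n → ℕ} {k : ℕ} {f : MvPolynomial (Fin n) ℂ} (i : Fin n)
    (hf : f ∈ G v (k + v i)) : pderiv i f ∈ G v k := by
  intro m hm
  rw [coeff_pderiv] at hm
  have := hf (m + Finsupp.single i 1) (fun h => hm (by simp [h]))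
  rw [wt_add, wt_single] at this
  omega

/-- constant coefficient second order operator -/
def lapG (g : Fin n → Fin n → ℂ) : MvPolynomial (Fin n) ℂ →ₗ[ℂ] MvPolynomial (Fin n) ℂ :=
  ∑ i, ∑ j, g i j • ((pderiv i).toLinearMap ∘ₗ (pderiv j).toLinearMap)

lemma lapG_apply (g : Fin n → Fin n → ℂ) (f : MvPolynomial (Fin n) ℂ) :
    lapG g f = ∑ i, ∑ j, g i j • pderiv i (pderiv j f) := by
  simp [lapG, LinearMap.sum_apply]

def mixed (z w : Fin n) : MvPolynomial (Fin n) ℂ →ₗ[ℂ] MvPolynomial (Fin n) ℂ :=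
  (pderiv z).toLinearMap ∘ₗ (pderiv w).toLinearMap

lemma mixed_apply (z w : Fin n) (f : MvPolynomial (Fin n) ℂ) :
    mixed z w f = pderiv z (pderiv w f) := rfl

def vv (z w : Fin n) : Fin n → ℕ := fun i => if i = w then 0 else if i = z then 5 else 3

lemma mixed_G {z w : Fin n} (hzw : z ≠ w) {k : ℕ} {f : MvPolynomial (Fin n) ℂ}
    (hf : f ∈ G (vv z w) (k + 5)) : mixed z w f ∈ G (vv z w) k := by
  apply G_pderiv
  apply G_pderiv
  simpa [vv, hzw] using hf

lemma diff_G {z w : Fin n} (hzw : z ≠ w) {g : Fin n → Fin n → ℂ}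
    (hgw : ∀ j, j ≠ z → g w j = 0) (hgw' : ∀ j, j ≠ z → g j w = 0)
    {k : ℕ} {f : MvPolynomial (Fin n) ℂ} (hf : f ∈ G (vv z w) (k + 6)) :
    lapG g f - (g z w + g w z) • mixed z w f ∈ G (vv z w) k := by
  classical
  have key : lapG g f - (g z w + g w z) • mixed z w f =
      ∑ i, ∑ j, (if i = w ∨ j = w then 0 else g i j • pderiv i (pderiv j f)) := by
    rw [sub_eq_iff_eq_add, lapG_apply]
    have h1 : ∀ i j, g i j • pderiv i (pderiv j f) =
        (if i = w ∨ j = w then 0 else g i j • pderiv i (pderiv j f)) +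
        ((if i = z then (if j = w then g z w • mixed z w f else 0) else 0) +
        (if i = w then (if j = z then g w z • mixed z w f else 0) else 0)) := by
      intro i j
      by_cases hi : i = w
      · subst hi
        by_cases hj : j = z
        · subst hj; simp [hzw.symm, mixed_apply, pderiv_comm' i j]
        · simp [hj, hzw.symm, hgw j hj]
      · by_cases hj : j = w
        · subst hj
          by_cases hi' : i = z
          · subst hi'; simp [hzw, mixed_apply]
          · simp [hi', hi, hgw' i hi']
        · simp [hi, hj]
    rw [Finset.sum_congr rfl fun i _ => Finset.sum_congr rfl fun j _ => h1 i j]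
    simp only [Finset.sum_add_distrib]
    congr 1
    simp [add_smul, Finset.sum_ite_eq']
  rw [key]
  refine Submodule.sum_mem _ fun i _ => Submodule.sum_mem _ fun j _ => ?_
  split_ifs with h
  · exact Submodule.zero_mem _
  · push Not at h
    refine Submodule.smul_mem _ _ (G_pderiv i (G_pderiv j (G_mono ?_ hf)))
    simp only [vv, h.1, h.2, if_false]
    split_ifs <;> omega

lemma lapG_G {z w : Fin n} (hzw : z ≠ w) {g : Fin n → Fin n → ℂ}
    (hgw : ∀ j, j ≠ z → g w j = 0) (hgw' : ∀ j, j ≠ z → g j w = 0)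
    {k : ℕ} {f : MvPolynomial (Fin n) ℂ} (hf : f ∈ G (vv z w) (k + 5)) :
    lapG g f ∈ G (vv z w) k := by
  have h1 := diff_G hzw hgw hgw' (G_mono (by omega : k + 5 ≤ k + 6) hf)
  have h2 := Submodule.smul_mem _ (g z w + g w z) (mixed_G hzw hf)
  simpa using Submodule.add_mem _ h1 h2

lemma pow_G {T : MvPolynomial (Fin n) ℂ →ₗ[ℂ] MvPolynomial (Fin n) ℂ} {v : Fin n → ℕ}
    (hT : ∀ k f, f ∈ G v (k + 5) → T f ∈ G v k) (s : ℕ) :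
    ∀ k f, f ∈ G v (k + 5 * s) → (T ^ s) f ∈ G v k := by
  induction s with
  | zero => intro k f hf; simpa using hf
  | succ s ih =>
    intro k f hf
    rw [pow_succ_app]
    exact ih _ _ (hT _ _ (by rw [show k + 5 * s + 5 = k + 5 * (s + 1) by ring]; exact hf))

lemma pow_diff_G {T T0 : MvPolynomial (Fin n) ℂ →ₗ[ℂ] MvPolynomial (Fin n) ℂ} {v : Fin n → ℕ}
    (hT : ∀ k f, f ∈ G v (k + 5) → T f ∈ G v k) (hT0 : ∀ k f, f ∈ G v (k + 5) → T0 f ∈ G v k)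
    (hd : ∀ k f, f ∈ G v (k + 6) → T f - T0 f ∈ G v k) (s : ℕ) :
    ∀ k f, f ∈ G v (k + 5 * s + 1) → (T ^ s) f - (T0 ^ s) f ∈ G v k := by
  induction s with
  | zero => intro k f hf; simp
  | succ s ih =>
    intro k f hf
    rw [pow_succ_app, pow_succ_app]
    have e : (T ^ s) (T f) - (T0 ^ s) (T0 f) =
        (T ^ s) (T f - T0 f) + ((T ^ s) (T0 f) - (T0 ^ s) (T0 f)) := by
      rw [map_sub]; abel
    rw [e]
    refine Submodule.add_mem _ (pow_G hT s _ _ (hd _ _ ?_)) (ih _ _ (hT0 _ _ ?_))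
    · exact G_mono (by omega) hf
    · exact G_mono (by omega) hf

lemma mixed_pow_monomial {z w : Fin n} (hzw : z ≠ w) (s : ℕ) (m : Fin n →₀ ℕ) :
    ∃ c : ℂ, c ≠ 0 ∧ (mixed z w ^ s)
      (monomial (m + Finsupp.single z s + Finsupp.single w s) 1) = monomial m c := by
  classical
  induction s with
  | zero => exact ⟨1, one_ne_zero, by simp⟩
  | succ s ih =>
    obtain ⟨c, hc, e⟩ := ih
    refine ⟨((m w + s + 1 : ℕ) : ℂ) * ((m z + s + 1 : ℕ) : ℂ) * c, ?_, ?_⟩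
    · refine mul_ne_zero (mul_ne_zero ?_ ?_) hc
      · exact Nat.cast_ne_zero.mpr (by omega)
      · exact Nat.cast_ne_zero.mpr (by omega)
    · have h1 : mixed z w (monomial (m + Finsupp.single z (s+1) + Finsupp.single w (s+1)) (1:ℂ)) =
          (((m w + s + 1 : ℕ) : ℂ) * ((m z + s + 1 : ℕ) : ℂ)) •
            monomial (m + Finsupp.single z s + Finsupp.single w s) (1 : ℂ) := by
        rw [mixed_apply, pderiv_monomial, pderiv_monomial, smul_monomial]
        congr 1
        · congr 1
          ext i
          by_cases hi : i = z
          · subst hi; simp [hzw]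
          · by_cases hi' : i = w
            · subst hi'; simp [hzw]
            · simp [Ne.symm hi, Ne.symm hi']
        · simp [hzw, hzw.symm]; ring
      rw [pow_succ_app, h1, map_smul, e, smul_monomial]
      simp

/-- the key triangular identity -/
lemma triangular {z w : Fin n} (hzw : z ≠ w) {g : Fin n → Fin n → ℂ}
    (hgw : ∀ j, j ≠ z → g w j = 0) (hgw' : ∀ j, j ≠ z → g j w = 0) (hc : g z w + g w z ≠ 0)
    {s : ℕ} {P : MvPolynomial (Fin n) ℂ} (hP : P.IsHomogeneous s)
    (hPz : coeff (Finsupp.single z s) P ≠ 0) (m : Fin n →₀ ℕ) :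
    ∃ c : ℂ, c ≠ 0 ∧ (lapG g ^ s) (P * monomial (m + Finsupp.single w s) 1) - monomial m c
      ∈ G (vv z w) (wt (vv z w) m) := by
  classical
  set v := vv z w with hv
  set c0 := coeff (Finsupp.single z s) P with hc0
  have hvw : v w = 0 := by simp [hv, vv]
  have hvz : v z = 5 := by simp [hv, vv, hzw]
  have hv5 : ∀ i, v i ≤ 5 := by intro i; simp only [hv, vv]; split_ifs <;> omega
  have hv5' : ∀ i, i ≠ z → v i < 5 := by
    intro i hi; simp only [hv, vv, hi, if_false]; split_ifs <;> omega
  set P' := P - monomial (Finsupp.single z s) c0 with hP'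
  have hP'G : P' ∈ G v (5 * s) := by
    intro m' hm'
    have hne : m' ≠ Finsupp.single z s := by
      rintro rfl
      simp [hP', hc0] at hm'
    have hm2 : coeff m' P ≠ 0 := by
      simpa [hP', coeff_monomial, hne.symm] using hm'
    have hdeg : m'.degree = s := by
      by_contra h
      exact hm2 (hP.coeff_eq_zero h)
    rw [Finsupp.degree_eq_sum] at hdeg
    rw [← hdeg, Finset.mul_sum, wt]
    apply Finset.sum_lt_sum
    · intro i _; exact Nat.mul_le_mul_right _ (hv5 i)
    · by_contra hcon
      push Not at hcon
      apply hne
      have h0 : ∀ i, i ≠ z → m' i = 0 := by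
        intro i hi
        by_contra h
        have := hcon i (Finset.mem_univ _)
        exact absurd (Nat.mul_lt_mul_of_pos_right (hv5' i hi) (Nat.pos_of_ne_zero h)) (by omega)
      rw [Finset.sum_eq_single z (fun i _ hi => h0 i hi) (by simp)] at hdeg
      ext i
      by_cases hi : i = z
      · subst hi; simpa using hdeg
      · rw [h0 i hi]; simp [Ne.symm hi]
  set q : MvPolynomial (Fin n) ℂ := monomial (m + Finsupp.single w s) 1 with hq
  set k := wt v m with hk
  have hwq : wt v (m + Finsupp.single w s) = k := by rw [wt_add, wt_single, hvw]; omega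
  have hqG : q ∈ G v (k + 1) := G_monomial (by omega) _
  set γ := g z w + g w z with hγ
  set T0 : MvPolynomial (Fin n) ℂ →ₗ[ℂ] MvPolynomial (Fin n) ℂ := γ • mixed z w with hT0
  have hPG : P ∈ G v (5 * s + 1) := by
    have : P = P' + monomial (Finsupp.single z s) c0 := by rw [hP']; abel
    rw [this]
    refine Submodule.add_mem _ (G_mono (by omega) hP'G) (G_monomial ?_ _)
    rw [wt_single, hvz]; omega
  have hT : ∀ k f, f ∈ G v (k + 5) → lapG g f ∈ G v k := fun k f hf => lapG_G hzw hgw hgw' hf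
  have hT0G : ∀ k f, f ∈ G v (k + 5) → T0 f ∈ G v k := fun k f hf =>
    Submodule.smul_mem _ _ (mixed_G hzw hf)
  have d1 : (lapG g ^ s) (P * q) - (T0 ^ s) (P * q) ∈ G v k := by
    refine pow_diff_G hT hT0G (fun k f hf => diff_G hzw hgw hgw' hf) s k _ ?_
    exact G_mono (by omega) (G_mul hPG hqG)
  have d2 : (T0 ^ s) (P' * q) ∈ G v k :=
    pow_G hT0G s k _ (G_mono (by omega) (G_mul hP'G hqG))
  obtain ⟨c, hc', e⟩ := mixed_pow_monomial hzw s m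
  refine ⟨γ ^ s * c0 * c, mul_ne_zero (mul_ne_zero (pow_ne_zero _ hc) hPz) hc', ?_⟩
  have d3 : (T0 ^ s) (monomial (Finsupp.single z s) c0 * q) = monomial m (γ ^ s * c0 * c) := by
    have : monomial (Finsupp.single z s) c0 * q =
        c0 • monomial (m + Finsupp.single z s + Finsupp.single w s) 1 := by
      rw [hq, monomial_mul, smul_monomial]
      congr 1
      · congr 1; abel
    rw [this, hT0, smul_pow, LinearMap.smul_apply, map_smul, e, smul_monomial, smul_monomial]
    congr 1; simp; ring
  have e4 : (lapG g ^ s) (P * q) - monomial m (γ ^ s * c0 * c) =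
      ((lapG g ^ s) (P * q) - (T0 ^ s) (P * q)) + (T0 ^ s) (P' * q) := by
    rw [← d3, hP', sub_mul, map_sub]; abel
  rw [e4]
  exact Submodule.add_mem _ d1 d2

lemma lapG_surj {z w : Fin n} (hzw : z ≠ w) {g : Fin n → Fin n → ℂ}
    (hgw : ∀ j, j ≠ z → g w j = 0) (hgw' : ∀ j, j ≠ z → g j w = 0) (hc : g z w + g w z ≠ 0)
    {s : ℕ} {P : MvPolynomial (Fin n) ℂ} (hP : P.IsHomogeneous s)
    (hPz : coeff (Finsupp.single z s) P ≠ 0) (f : MvPolynomial (Fin n) ℂ) :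
    ∃ q, (lapG g ^ s) (P * q) = f := by
  classical
  set T : MvPolynomial (Fin n) ℂ →ₗ[ℂ] MvPolynomial (Fin n) ℂ :=
    (lapG g ^ s) ∘ₗ (LinearMap.mulLeft ℂ P) with hT
  suffices h : f ∈ LinearMap.range T by
    obtain ⟨q, hq⟩ := h; exact ⟨q, hq⟩
  have main : ∀ k, G (vv z w) k ≤ LinearMap.range T := by
    intro k
    induction k with
    | zero => intro f hf; rw [G_zero hf]; exact Submodule.zero_mem _
    | succ k ih =>
      intro f hf
      rw [f.as_sum]
      refine Submodule.sum_mem _ fun m hm => ?_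
      have hw : wt (vv z w) m < k + 1 := hf m (by simpa using hm)
      obtain ⟨c, hc, h⟩ := triangular hzw hgw hgw' hc hP hPz m
      have h1 : monomial m c ∈ LinearMap.range T := by
        have h2 := ih (G_mono (by omega) h)
        have h3 : T (monomial (m + Finsupp.single w s) 1) ∈ LinearMap.range T := ⟨_, rfl⟩
        have := Submodule.sub_mem _ h3 h2
        rwa [show T (monomial (m + Finsupp.single w s) 1) =
          (lapG g ^ s) (P * monomial (m + Finsupp.single w s) 1) from rfl, sub_sub_cancel] at this
      have h2 := Submodule.smul_mem _ (coeff m f * c⁻¹) h1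
      rw [smul_monomial, smul_eq_mul, mul_assoc, inv_mul_cancel₀ hc, mul_one] at h2
      exact h2
  refine main (∑ m ∈ f.support, (wt (vv z w) m + 1)) ?_
  intro m hm
  have := Finset.single_le_sum (f := fun m => wt (vv z w) m + 1) (fun _ _ => Nat.zero_le _)
    (show m ∈ f.support by simpa using hm)
  omega

end weights

end PH

namespace PH

section coords

variable {n : ℕ}

lemma pderiv_lin (c : Fin n → ℂ) (k : Fin n) :
    pderiv k (∑ j, C (c j) * X j : MvPolynomial (Fin n) ℂ) = C (c k) := by
  rw [map_sum, Finset.sum_eq_single k]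
  · simp [pderiv_mul]
  · intro j _ hj; simp [pderiv_mul, pderiv_X_of_ne hj]
  · simp

lemma chain (c : Fin n → Fin n → ℂ) (k : Fin n) (f : MvPolynomial (Fin n) ℂ) :
    pderiv k (aeval (fun i => ∑ j, C (c i j) * X j : Fin n → MvPolynomial (Fin n) ℂ) f) =
      ∑ i, C (c i k) * aeval (fun i => ∑ j, C (c i j) * X j) (pderiv i f) := by
  classical
  set ξ : Fin n → MvPolynomial (Fin n) ℂ := fun i => ∑ j, C (c i j) * X j with hξ
  induction f using MvPolynomial.induction_on with
  | C a => simp [aeval_C, algebraMap_eq]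
  | add p q hp hq => simp only [map_add, hp, hq, mul_add, Finset.sum_add_distrib]
  | mul_X p i hp =>
    rw [map_mul, aeval_X, pderiv_mul, hp, show pderiv k (ξ i) = C (c i k) from pderiv_lin _ _]
    have : ∀ l, C (c l k) * aeval ξ (pderiv l (p * X i)) =
        C (c l k) * aeval ξ (pderiv l p) * ξ i +
          (if l = i then aeval ξ p * C (c i k) else 0) := by
      intro l
      rw [pderiv_mul, map_add, map_mul, map_mul, aeval_X]
      split_ifs with h
      · subst h; simp; ring
      · rw [pderiv_X_of_ne (Ne.symm h)]; simp; ring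
    rw [Finset.sum_congr rfl fun l _ => this l, Finset.sum_add_distrib, Finset.sum_mul]
    simp

lemma lap_chain (c : Fin n → Fin n → ℂ) (f : MvPolynomial (Fin n) ℂ) :
    lapL n (aeval (fun i => ∑ j, C (c i j) * X j : Fin n → MvPolynomial (Fin n) ℂ) f) =
      aeval (fun i => ∑ j, C (c i j) * X j : Fin n → MvPolynomial (Fin n) ℂ)
        (lapG (fun i j => ∑ k, c i k * c j k) f) := by
  rw [lapL_apply, lap, lapG_apply]
  simp only [chain, map_sum, pderiv_C_mul, smul_eq_C_mul, map_mul, Finset.mul_sum, aeval_C,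
    algebraMap_eq, Finset.sum_mul]
  rw [Finset.sum_comm]
  refine Finset.sum_congr rfl fun i _ => ?_
  rw [Finset.sum_comm]
  refine Finset.sum_congr rfl fun j _ => ?_
  refine Finset.sum_congr rfl fun k _ => ?_
  rw [pderiv_comm' i j]
  ring

lemma lap_chain_pow (c : Fin n → Fin n → ℂ) (s : ℕ) (f : MvPolynomial (Fin n) ℂ) :
    (lapL n ^ s) (aeval (fun i => ∑ j, C (c i j) * X j : Fin n → MvPolynomial (Fin n) ℂ) f) =
      aeval (fun i => ∑ j, C (c i j) * X j : Fin n → MvPolynomial (Fin n) ℂ)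
        ((lapG (fun i j => ∑ k, c i k * c j k) ^ s) f) := by
  induction s generalizing f with
  | zero => simp
  | succ s ih => rw [pow_succ_app, pow_succ_app, lap_chain, ih]

lemma eval_single {s : ℕ} {Q : MvPolynomial (Fin n) ℂ} (hQ : Q.IsHomogeneous s) (z : Fin n) :
    eval (Pi.single z 1) Q = coeff (Finsupp.single z s) Q := by
  classical
  rw [eval_eq']
  have hz : ∀ d ∈ Q.support, d ≠ Finsupp.single z s →
      coeff d Q * ∏ i, (Pi.single z 1 : Fin n → ℂ) i ^ d i = 0 := by
    intro d hd hne
    have hdeg : d.degree = s := by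
      by_contra h
      exact (mem_support_iff.mp hd) (hQ.coeff_eq_zero h)
    have : ∃ i, i ≠ z ∧ d i ≠ 0 := by
      by_contra hcon
      push Not at hcon
      apply hne
      rw [Finsupp.degree_eq_sum, Finset.sum_eq_single z (fun i _ hi => hcon i hi) (by simp)] at hdeg
      ext i
      by_cases hi : i = z
      · subst hi; simpa using hdeg
      · rw [hcon i hi]; simp [Ne.symm hi]
    obtain ⟨i, hi, hi'⟩ := this
    rw [Finset.prod_eq_zero (Finset.mem_univ i), mul_zero]
    simp [Pi.single_apply, hi, hi']
  rw [Finset.sum_eq_single (Finsupp.single z s) hz]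
  · rw [Finset.prod_eq_one, mul_one]
    intro i _
    by_cases hi : i = z
    · subst hi; simp
    · simp [Ne.symm hi]
  · intro h
    rw [notMem_support_iff.mp h, zero_mul]

lemma base1 {s : ℕ} {P : MvPolynomial (Fin n) ℂ} (hP : P.IsHomogeneous s) {a : Fin n → ℂ}
    (ha : ∑ i, a i ^ 2 = 0) {z w : Fin n} (hzw : z ≠ w) (haz : a z = 1) (haw : a w ≠ 0)
    (hPa : eval a P ≠ 0) :
    Good P s ∧ ∃ h : MvPolynomial (Fin n) ℂ, h.IsHomogeneous s ∧ lapL n h = 0 ∧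
      (lapL n ^ s) (P * h) ≠ 0 := by
  classical
  set c : Fin n → Fin n → ℂ := fun i k => if i = w then a k else if i = z then
    (if k = z then 1 else 0) else ((if k = i then 1 else 0) - (if k = z then a i else 0)) with hc
  set ξ : Fin n → MvPolynomial (Fin n) ℂ := fun i => ∑ j, C (c i j) * X j with hξ
  set g : Fin n → Fin n → ℂ := fun i j => ∑ k, c i k * c j k with hg
  have hsymm : ∀ i j, g i j = g j i := by
    intro i j; simp only [hg, mul_comm]
  have hgw : ∀ j, j ≠ z → g w j = 0 := by
    intro j hj
    by_cases hjw : j = w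
    · subst hjw
      simp only [hg, hc, if_true, ← sq]; exact ha
    · simp only [hg, hc, if_true, hj, hjw, if_false, mul_sub, Finset.sum_sub_distrib]
      simp [haz]
  have hgw' : ∀ j, j ≠ z → g j w = 0 := fun j hj => by rw [hsymm]; exact hgw j hj
  have hgzw : g z w = 1 := by simp [hg, hc, hzw, haz]
  have hgne : g z w + g w z ≠ 0 := by rw [hsymm w z, hgzw]; norm_num
  have hξz : ξ z = X z := by simp [hξ, hc, hzw]
  have hξw : ξ w = ∑ j, C (a j) * X j := by simp [hξ, hc]
  have hξi : ∀ i, i ≠ z → i ≠ w → ξ i = X i - C (a i) * X z := by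
    intro i h1 h2
    have e : ∀ j, C (c i j) * (X j : MvPolynomial (Fin n) ℂ) =
        (if j = i then X j else 0) - (if j = z then C (a i) * X j else 0) := by
      intro j
      simp only [hc, h1, h2, if_false]
      split_ifs <;> simp [sub_mul]
    simp only [hξ, e, Finset.sum_sub_distrib, Finset.sum_ite_eq', Finset.mem_univ, if_true]
  set rest : Finset (Fin n) := (Finset.univ.erase z).erase w with hrest
  have hsplit : ∀ {M : Type} [AddCommGroup M] (F : Fin n → M),
      ∑ i, F i = F z + (F w + ∑ i ∈ rest, F i) := by
    intro M _ F
    rw [hrest, Finset.add_sum_erase _ _ (by simp [hzw.symm]), Finset.add_sum_erase _ _ (by simp)]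
  set η : Fin n → MvPolynomial (Fin n) ℂ := fun i => if i = w then
    C (a w)⁻¹ * (X w - X z - ∑ j ∈ rest, C (a j) * (X j + C (a j) * X z)) else if i = z then X z
    else X i + C (a i) * X z with hη
  have hψη : ∀ i, aeval ξ (η i) = X i := by
    intro i
    by_cases hiw : i = w
    · subst hiw
      have h1 : ∀ j ∈ rest, C (a j) * (ξ j + C (a j) * ξ z) = C (a j) * X j := by
        intro j hj
        rw [hrest, Finset.mem_erase, Finset.mem_erase] at hj
        rw [hξi j hj.2.1 hj.1, hξz]; ring
      simp only [hη, if_true, map_mul, map_sub, map_sum, map_add, aeval_X, aeval_C, algebraMap_eq]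
      rw [Finset.sum_congr rfl h1, hξw, hsplit, hξz, haz]
      have : C (a i)⁻¹ * C (a i) = (1 : MvPolynomial (Fin n) ℂ) := by
        rw [← C_mul, inv_mul_cancel₀ haw, C_1]
      rw [C_1]
      linear_combination (X i) * this
    · by_cases hiz : i = z
      · subst hiz; simp [hη, hzw, hξz]
      · simp [hη, hiw, hiz, hξi i hiz hiw, hξz, algebraMap_eq]
  have hψχ : ∀ f, aeval ξ (aeval η f) = f := by
    intro f
    have : (aeval ξ).comp (aeval η) = AlgHom.id ℂ (MvPolynomial (Fin n) ℂ) := by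
      apply MvPolynomial.algHom_ext
      intro i
      rw [AlgHom.comp_apply, aeval_X, hψη]; rfl
    exact congrArg (fun φ => φ f) this
  have hηh : ∀ i, (η i).IsHomogeneous 1 := by
    intro i
    have hX := fun i => isHomogeneous_X ℂ (σ := Fin n) i
    simp only [hη]
    split_ifs
    · refine IsHomogeneous.C_mul (((hX w).sub (hX z)).sub (IsHomogeneous.sum _ _ _ fun j _ => ?_)) _
      exact ((hX j).add ((hX z).C_mul _)).C_mul _
    · exact hX z
    · exact (hX i).add ((hX z).C_mul _)
  have hξh : ∀ i, (ξ i).IsHomogeneous 1 := by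
    intro i
    exact IsHomogeneous.sum _ _ _ fun j _ => (isHomogeneous_X ℂ j).C_mul _
  set P' := aeval η P with hP'
  have hP'h : P'.IsHomogeneous s := by
    have := hP.aeval η hηh
    rwa [one_mul] at this
  have hηa : ∀ i, eval (Pi.single z 1) (η i) = a i := by
    intro i
    by_cases hiw : i = w
    · subst hiw
      have h1 : ∀ j ∈ rest, a j * ((Pi.single z 1 : Fin n → ℂ) j + a j * 1) = a j ^ 2 := by
        intro j hj
        rw [hrest, Finset.mem_erase, Finset.mem_erase] at hj
        rw [Pi.single_eq_of_ne hj.2.1]; ring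
      simp only [hη, if_true, map_mul, map_sub, map_sum, map_add, eval_X, eval_C, Pi.single_eq_same]
      rw [Finset.sum_congr rfl h1, Pi.single_eq_of_ne hzw.symm]
      rw [hsplit, haz] at ha
      have : ∑ j ∈ rest, a j ^ 2 = - 1 - a i ^ 2 := by linear_combination ha
      rw [this]; field_simp; ring
    · by_cases hiz : i = z
      · subst hiz; simp [hη, hzw, haz]
      · simp [hη, hiw, hiz]
  have hP'z : coeff (Finsupp.single z s) P' ≠ 0 := by
    rw [← eval_single hP'h, hP']
    have : eval (Pi.single z 1) (aeval η P) = eval a P := by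
      have h2 : ((aeval (Pi.single z 1 : Fin n → ℂ)).comp (aeval η)) = aeval (R := ℂ) a := by
        apply MvPolynomial.algHom_ext
        intro i
        simp only [AlgHom.comp_apply, aeval_X]
        rw [← hηa i]; rfl
      exact congrArg (fun φ => φ P) h2
    rwa [this]
  constructor
  · intro f
    obtain ⟨q, hq⟩ := lapG_surj hzw hgw hgw' hgne hP'h hP'z (aeval η ((lapL n ^ s) f))
    refine ⟨aeval ξ q, ?_⟩
    have h1 : P * aeval ξ q = aeval ξ (P' * q) := by rw [map_mul, hP', hψχ]
    rw [map_sub, h1, lap_chain_pow, hq, hψχ, sub_self]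
  · obtain ⟨b, hb, hbG⟩ := triangular hzw hgw hgw' hgne hP'h hP'z 0
    have hvw : vv z w w = 0 := by simp [vv]
    have hwt0 : wt (vv z w) 0 = 0 := by simp [wt]
    rw [hwt0, zero_add] at hbG
    have hb0 := sub_eq_zero.mp (G_zero hbG)
    refine ⟨aeval ξ (monomial (Finsupp.single w s) (1 : ℂ)), ?_, ?_, ?_⟩
    · have := IsHomogeneous.aeval (isHomogeneous_monomial (1 : ℂ) (n := s)
        (d := Finsupp.single w s) (by simp)) ξ hξh
      rw [one_mul] at this
      exact this
    · rw [lap_chain, G_zero (lapG_G hzw hgw hgw' (k := 0) (G_monomial ?_ _)), map_zero]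
      rw [wt_single, hvw]; omega
    · have h1 : P * aeval ξ (monomial (Finsupp.single w s) (1 : ℂ)) =
          aeval ξ (P' * monomial (Finsupp.single w s) (1 : ℂ)) := by rw [map_mul, hP', hψχ]
      rw [h1, lap_chain_pow, hb0]
      rw [show monomial (0 : Fin n →₀ ℕ) b = C b from rfl, aeval_C, algebraMap_eq]
      simpa using hb

lemma eval_smul_homog {s : ℕ} {P : MvPolynomial (Fin n) ℂ} (hP : P.IsHomogeneous s)
    (t : ℂ) (a : Fin n → ℂ) : eval (fun i => t * a i) P = t ^ s * eval a P := by
  rw [eval_eq', eval_eq', Finset.mul_sum]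
  refine Finset.sum_congr rfl fun d hd => ?_
  have hdeg : d.degree = s := by
    by_contra h
    exact (mem_support_iff.mp hd) (hP.coeff_eq_zero h)
  rw [Finsupp.degree_eq_sum] at hdeg
  simp only [mul_pow, Finset.prod_mul_distrib]
  rw [Finset.prod_pow_eq_pow_sum, hdeg]; ring

lemma base2 {s : ℕ} {P : MvPolynomial (Fin n) ℂ} (hP : P.IsHomogeneous s) {a : Fin n → ℂ}
    (ha : ∑ i, a i ^ 2 = 0) (ha0 : a ≠ 0) (hPa : eval a P ≠ 0) :
    Good P s ∧ ∃ h : MvPolynomial (Fin n) ℂ, h.IsHomogeneous s ∧ lapL n h = 0 ∧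
      (lapL n ^ s) (P * h) ≠ 0 := by
  obtain ⟨z, hz⟩ := Function.ne_iff.mp ha0
  simp only [Pi.zero_apply] at hz
  obtain ⟨w, hwz, hw⟩ : ∃ w, w ≠ z ∧ a w ≠ 0 := by
    by_contra hcon
    push Not at hcon
    rw [Finset.sum_eq_single z (fun i _ hi => by simp [hcon i hi]) (by simp)] at ha
    exact hz (by simpa using ha)
  refine base1 hP (a := fun i => (a z)⁻¹ * a i) ?_ hwz.symm (inv_mul_cancel₀ hz)
    (mul_ne_zero (inv_ne_zero hz) hw) ?_
  · simp only [mul_pow, ← Finset.mul_sum, ha, mul_zero]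
  · rw [eval_smul_homog hP]
    exact mul_ne_zero (pow_ne_zero _ (inv_ne_zero hz)) hPa

end coords

lemma exists_null {n : ℕ} (hn : 2 ≤ n) {P : MvPolynomial (Fin n) ℂ} (h : ¬ rho n ∣ P) :
    ∃ a : Fin n → ℂ, ∑ i, a i ^ 2 = 0 ∧ eval a P ≠ 0 := by
  by_contra hcon
  push Not at hcon
  apply h
  have hsq : Squarefree (rho n) := by
    intro p ⟨q, hq⟩
    have hd : ∀ i, p ∣ X i := by
      intro i
      have h1 := pderiv_rho i
      rw [hq, pderiv_mul, pderiv_mul] at h1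
      have h2 : p ∣ 2 * X i := by
        rw [← h1]
        refine ⟨2 * pderiv i p * q + p * pderiv i q, ?_⟩
        ring
      have h3 : (X i : MvPolynomial (Fin n) ℂ) = C (2⁻¹) * (2 * X i) := by
        rw [← map_ofNat C 2, ← mul_assoc, ← C_mul]; simp
      rw [h3]
      exact h2.mul_left _
    set i0 : Fin n := ⟨0, by omega⟩
    set i1 : Fin n := ⟨1, by omega⟩
    have hp0 : Prime (X i0 : MvPolynomial (Fin n) ℂ) := MvPolynomial.X_prime
    obtain ⟨r, hr⟩ := hd i0
    rcases hp0.irreducible.isUnit_or_isUnit hr with hu | hu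
    · exact hu
    · exfalso
      have h5 : (X i0 : MvPolynomial (Fin n) ℂ) ∣ X i1 := by
        refine dvd_trans ?_ (hd i1)
        rw [hr]; exact (associated_mul_unit_left p r hu).dvd
      rw [X_dvd_X] at h5
      simp [i0, i1] at h5
  have hmem : P ∈ (Ideal.span {rho n}).radical := by
    rw [← vanishingIdeal_zeroLocus_eq_radical (K := ℂ)]
    rw [mem_vanishingIdeal_iff]
    intro x hx
    rw [mem_zeroLocus_iff] at hx
    have := hx (rho n) (Ideal.mem_span_singleton_self _)
    refine hcon x ?_
    simpa [rho] using this
  obtain ⟨k, hk⟩ := hmem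
  rw [Ideal.mem_span_singleton] at hk
  exact hsq.isRadical k P hk

end PH

namespace PH

section main

variable {n : ℕ}

lemma lin_ext {M : Type*} [AddCommGroup M] [Module ℂ M] (T S : MvPolynomial (Fin n) ℂ →ₗ[ℂ] M)
    (h : ∀ d f, f.IsHomogeneous d → T f = S f) (f : MvPolynomial (Fin n) ℂ) : T f = S f := by
  rw [← sum_homogeneousComponent f, map_sum, map_sum]
  exact Finset.sum_congr rfl fun i _ => h i _ (homogeneousComponent_isHomogeneous i f)

lemma comp_homog {d : ℕ} {f : MvPolynomial (Fin n) ℂ} (hf : f.IsHomogeneous d) (e : ℕ) :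
    homogeneousComponent e f = if e = d then f else 0 :=
  homogeneousComponent_of_mem hf

lemma comp_mul {k : ℕ} {h : MvPolynomial (Fin n) ℂ} (hh : h.IsHomogeneous k) (m : ℕ)
    (P : MvPolynomial (Fin n) ℂ) :
    homogeneousComponent (m + k) (P * h) = homogeneousComponent m P * h := by
  refine lin_ext (homogeneousComponent (m + k) ∘ₗ LinearMap.mulRight ℂ h)
    (LinearMap.mulRight ℂ h ∘ₗ homogeneousComponent m) ?_ P
  intro d f hf
  simp only [LinearMap.comp_apply, LinearMap.mulRight_apply]
  rw [comp_homog (hf.mul hh), comp_homog hf]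
  by_cases e : m = d
  · simp [e]
  · rw [if_neg (by omega), if_neg e, zero_mul]

lemma comp_mul_low {k : ℕ} {h : MvPolynomial (Fin n) ℂ} (hh : h.IsHomogeneous k) {D : ℕ}
    (hD : D < k) (P : MvPolynomial (Fin n) ℂ) : homogeneousComponent D (P * h) = 0 := by
  refine lin_ext (homogeneousComponent D ∘ₗ LinearMap.mulRight ℂ h) 0 ?_ P
  intro d f hf
  simp only [LinearMap.comp_apply, LinearMap.mulRight_apply, LinearMap.zero_apply]
  rw [comp_homog (hf.mul hh), if_neg (by omega)]

lemma comp_lap (M d : ℕ) (f : MvPolynomial (Fin n) ℂ) :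
    homogeneousComponent d ((lapL n ^ M) f) =
      (lapL n ^ M) (homogeneousComponent (d + 2 * M) f) := by
  refine lin_ext (homogeneousComponent d ∘ₗ (lapL n ^ M))
    ((lapL n ^ M) ∘ₗ homogeneousComponent (d + 2 * M)) ?_ f
  intro e f hf
  simp only [LinearMap.comp_apply]
  rw [comp_homog hf]
  by_cases h : e < 2 * M
  · rw [lapL_pow_low hf h, if_neg (by omega)]; simp
  · rw [comp_homog (lapL_pow_homog hf M)]
    by_cases h2 : d + 2 * M = e
    · rw [if_pos h2, if_pos (by omega)]
    · rw [if_neg h2, if_neg (by omega), map_zero]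

lemma lap_comp_zero {M : ℕ} {f : MvPolynomial (Fin n) ℂ} (hf : (lapL n ^ M) f = 0) (D : ℕ) :
    (lapL n ^ M) (homogeneousComponent D f) = 0 := by
  by_cases h : D < 2 * M
  · exact lapL_pow_low (homogeneousComponent_isHomogeneous D f) h
  · obtain ⟨d, rfl⟩ : ∃ d, D = d + 2 * M := ⟨D - 2 * M, by omega⟩
    rw [← comp_lap, hf, map_zero]

/-- the homogeneous case -/
lemma good_homog (hn : 2 ≤ n) (m : ℕ) : ∀ (N : ℕ) (P : MvPolynomial (Fin n) ℂ), P ≠ 0 →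
    P.IsHomogeneous m →
    (∀ k h, h.IsHomogeneous k → lapL n h = 0 → (lapL n ^ (N + 1)) (P * h) = 0) → Good P N := by
  induction m using Nat.strong_induction_on with
  | _ m ih =>
  intro N P hP0 hP hyp
  rcases Nat.eq_zero_or_pos m with hm | hm
  · subst hm
    have e := homogeneousComponent_zero P
    rw [comp_homog hP, if_pos rfl] at e
    set c := coeff 0 P
    have hc : c ≠ 0 := by
      intro h; apply hP0; rw [e, h, C_0]
    intro f
    refine ⟨C c⁻¹ * f, ?_⟩
    rw [e, ← mul_assoc, ← C_mul, mul_inv_cancel₀ hc, C_1, one_mul, sub_self, map_zero]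
  by_cases hdvd : rho n ∣ P
  · obtain ⟨P1, hP1⟩ := hdvd
    rw [mul_comm] at hP1
    have hm2 : 2 ≤ m := by
      by_contra hlt
      apply hP0
      have := comp_mul_low (rho_homog n) (D := m) (by omega) P1
      rwa [← hP1, comp_homog hP, if_pos rfl] at this
    obtain ⟨l, rfl⟩ : ∃ l, m = l + 2 := ⟨m - 2, by omega⟩
    set P' := homogeneousComponent l P1 with hP'
    have hPe : P = rho n * P' := by
      have := comp_mul (rho_homog n) l P1
      rw [← hP1, comp_homog hP, if_pos rfl, mul_comm] at this
      exact this
    have hP'h : P'.IsHomogeneous l := homogeneousComponent_isHomogeneous _ _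
    have hP'0 : P' ≠ 0 := by
      intro h; apply hP0; rw [hPe, h, mul_zero]
    have hyp' : ∀ k h, h.IsHomogeneous k → lapL n h = 0 → (lapL n ^ N) (P' * h) = 0 := by
      intro k h hh hl
      have := hyp k h hh hl
      rw [hPe, mul_assoc] at this
      exact rho_inj (by omega) (hP'h.mul hh) N this
    cases N with
    | zero =>
      exfalso
      have := hyp' 0 1 (isHomogeneous_one _ _) (by rw [lapL_apply]; simp [lap])
      apply hP'0
      simpa using this
    | succ N =>
      rw [hPe]
      exact good_rho_mul (by omega) (ih l (by omega) N P' hP'0 hP'h hyp')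
  · obtain ⟨a, ha, hPa⟩ := exists_null hn hdvd
    have ha0 : a ≠ 0 := by
      rintro rfl
      apply hPa
      have := eval_smul_homog hP 0 0
      rw [zero_pow (by omega), zero_mul] at this
      simpa using this
    obtain ⟨hg, h, hh, hl, hne⟩ := base2 hP ha ha0 hPa
    refine hg.mono ?_
    by_contra hlt
    exact hne (pow_zero_of_le _ (by omega) (hyp m h hh hl))

lemma good_of_top {P : MvPolynomial (Fin n) ℂ} {N : ℕ}
    (hg : Good (homogeneousComponent P.totalDegree P) N) : Good P N := by
  set m := P.totalDegree with hm
  set Pm := homogeneousComponent m P with hPm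
  have hPmh : Pm.IsHomogeneous m := homogeneousComponent_isHomogeneous _ _
  have main : ∀ D, ∀ f : MvPolynomial (Fin n) ℂ, (∀ j, D ≤ j → homogeneousComponent j f = 0) →
      f ∈ goodSub P N := by
    intro D
    induction D with
    | zero =>
      intro f hf
      have : f = 0 := by
        rw [← sum_homogeneousComponent f]
        exact Finset.sum_eq_zero fun i _ => hf i (Nat.zero_le _)
      rw [this]; exact Submodule.zero_mem _
    | succ D ih =>
      intro f hf
      have hfD : (homogeneousComponent D f).IsHomogeneous D :=
        homogeneousComponent_isHomogeneous _ _
      obtain ⟨q, hq⟩ := hg (homogeneousComponent D f)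
      have hu := lap_comp_zero hq D
      rw [map_sub, comp_homog hfD, if_pos rfl] at hu
      by_cases hD : D < m
      · rw [mul_comm, comp_mul_low hPmh hD, sub_zero] at hu
        have h1 : f - homogeneousComponent D f ∈ goodSub P N := by
          apply ih
          intro j hj
          rw [map_sub, comp_homog hfD]
          split_ifs with h
          · rw [h, sub_self]
          · rw [hf j (by omega), sub_zero]
        have h2 : homogeneousComponent D f ∈ goodSub P N := ⟨0, by simpa using hu⟩
        simpa using Submodule.add_mem _ h1 h2
      · obtain ⟨k, rfl⟩ : ∃ k, D = k + m := ⟨D - m, by omega⟩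
        rw [mul_comm Pm, comp_mul hPmh] at hu
        set qk := homogeneousComponent k q with hqk
        have hqkh : qk.IsHomogeneous k := homogeneousComponent_isHomogeneous _ _
        set u := homogeneousComponent (k + m) f - qk * Pm with hu'
        have huh : u.IsHomogeneous (k + m) := hfD.sub (hqkh.mul hPmh)
        have h1 : f - P * qk - u ∈ goodSub P N := by
          apply ih
          intro j hj
          obtain ⟨i, rfl⟩ : ∃ i, j = i + k := ⟨j - k, by omega⟩
          rw [map_sub, map_sub, comp_mul hqkh, comp_homog huh]
          by_cases h : i = m
          · rw [h, if_pos (by omega), hu', add_comm m k]; ring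
          · rw [if_neg (by omega), hf _ (by omega),
              homogeneousComponent_eq_zero i P (by omega)]
            simp
        have h2 : u ∈ goodSub P N := ⟨0, by simpa using hu⟩
        have h3 : P * qk ∈ goodSub P N := ⟨qk, by simp⟩
        have := Submodule.add_mem _ (Submodule.add_mem _ h1 h2) h3
        simpa using this
  intro f
  refine main (f.totalDegree + 1) f fun j hj => ?_
  exact homogeneousComponent_eq_zero j f (by omega)

lemma top_ne_zero {P : MvPolynomial (Fin n) ℂ} (hP : P ≠ 0) :
    homogeneousComponent P.totalDegree P ≠ 0 := by
  obtain ⟨d, hd, e⟩ := Finset.exists_mem_eq_sup P.support (support_nonempty.mpr hP)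
    (fun s => s.sum fun _ e => e)
  intro h
  have h1 := coeff_homogeneousComponent P.totalDegree P d
  rw [h, if_pos ?_] at h1
  · exact (mem_support_iff.mp hd) (by simpa using h1.symm)
  · rw [totalDegree, e]; rfl

lemma good_general (hn : 2 ≤ n) {P : MvPolynomial (Fin n) ℂ} (hP : P ≠ 0) {N : ℕ}
    (hyp : ∀ h, lapL n h = 0 → (lapL n ^ (N + 1)) (P * h) = 0) : Good P N := by
  apply good_of_top
  refine good_homog hn P.totalDegree N _ (top_ne_zero hP)
    (homogeneousComponent_isHomogeneous _ _) ?_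
  intro k h hh hl
  rw [← comp_mul hh]
  exact lap_comp_zero (hyp h hl) _

lemma bound_homog (d : ℕ) : ∀ (P h : MvPolynomial (Fin n) ℂ), P.IsHomogeneous d → lapL n h = 0 →
    (lapL n ^ (d + 1)) (P * h) = 0 := by
  induction d using Nat.strong_induction_on with
  | _ d ih =>
  intro P h hP hl
  rw [pow_succ_app, lapL_mul, hl, mul_zero, add_zero]
  rcases Nat.eq_zero_or_pos d with hd | hd
  · subst hd
    have e := homogeneousComponent_zero P
    rw [comp_homog hP, if_pos rfl] at e
    rw [lapL_low hP (by omega), e]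
    simp
  · rw [map_add]
    have h1 : (lapL n ^ d) (lapL n P * h) = 0 := by
      by_cases h2 : d < 2
      · rw [lapL_low hP h2, zero_mul, map_zero]
      · exact pow_zero_of_le _ (by omega) (ih (d - 2) (by omega) _ h (lapL_homog hP) hl)
    have h2 : (lapL n ^ d) (2 * ∑ i, pderiv i P * pderiv i h) = 0 := by
      rw [two_mul, map_add, map_sum, Finset.sum_eq_zero, add_zero]
      intro i _
      exact pow_zero_of_le _ (by omega)
        (ih (d - 1) (by omega) _ (pderiv i h) hP.pderiv (by rw [lapL_pderiv, hl, map_zero]))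
    rw [h1, h2, add_zero]

lemma bound_general (P h : MvPolynomial (Fin n) ℂ) (hl : lapL n h = 0) :
    (lapL n ^ (P.totalDegree + 1)) (P * h) = 0 := by
  conv_lhs => rw [← sum_homogeneousComponent P, Finset.sum_mul, map_sum]
  refine Finset.sum_eq_zero fun i hi => ?_
  rw [sum_homogeneousComponent]
  rw [Finset.mem_range] at hi
  exact pow_zero_of_le _ hi
    (bound_homog i _ h (homogeneousComponent_isHomogeneous _ _) hl)

lemma good_NP (hn : 2 ≤ n) {P : MvPolynomial (Fin n) ℂ} (hP : P ≠ 0) {NP : ℕ}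
    (hNP : NP = sSup {d : ℕ | ∃ h : MvPolynomial (Fin n) ℂ,
      IsHarmonicPoly n h ∧ pdeg n (P * h) = d}) : Good P NP := by
  refine good_general hn hP fun h hl => ?_
  have hb : ∀ h, lapL n h = 0 →
      P.totalDegree ∈ {N : ℕ | (lap n)^[N + 1] (P * h) = 0} := by
    intro h hl
    rw [Set.mem_ofPred_eq, lap_iter]
    exact bound_general P h hl
  have hle : pdeg n (P * h) ≤ NP := by
    rw [hNP]
    refine le_csSup ⟨P.totalDegree, ?_⟩ ⟨h, by rw [IsHarmonicPoly, ← lapL_apply, hl], rfl⟩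
    rintro d ⟨h', hh', rfl⟩
    exact Nat.sInf_le (hb h' (by rw [lapL_apply]; exact hh'))
  have hmem : (lap n)^[pdeg n (P * h) + 1] (P * h) = 0 := Nat.sInf_mem ⟨_, hb h hl⟩
  rw [lap_iter] at hmem
  exact pow_zero_of_le _ (by omega) hmem

end main

end PH

namespace PH

lemma evalR_continuous {n : ℕ} (Q : MvPolynomial (Fin n) ℂ) :
    Continuous (fun x : En n => evalR Q x) := by
  have h : Continuous (fun x : En n => (fun i => (x i : ℂ) : Fin n → ℂ)) := by fun_prop
  exact (MvPolynomial.continuous_eval Q).comp h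

/-- restriction of polynomials to `K` -/
def restr {n : ℕ} (K : Set (En n)) : MvPolynomial (Fin n) ℂ →ₐ[ℂ] C(K, ℂ) :=
  aeval fun i => ⟨fun x : K => ((x : En n) i : ℂ), by fun_prop⟩

lemma restr_apply {n : ℕ} (K : Set (En n)) (Q : MvPolynomial (Fin n) ℂ) (x : K) :
    restr K Q x = evalR Q (x : En n) := by
  induction Q using MvPolynomial.induction_on with
  | C a => simp [restr, evalR, aeval_C]
  | add p q hp hq => rw [map_add, ContinuousMap.add_apply, hp, hq, evalR, evalR, evalR, map_add]
  | mul_X p i hp =>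
    rw [map_mul, ContinuousMap.mul_apply, hp, evalR, evalR, map_mul, eval_X]
    simp [restr]

lemma restr_star {n : ℕ} (K : Set (En n)) (Q : MvPolynomial (Fin n) ℂ) :
    star (restr K Q) = restr K (map (starRingEnd ℂ) Q) := by
  ext x
  rw [ContinuousMap.star_apply, restr_apply, restr_apply]
  induction Q using MvPolynomial.induction_on with
  | C a => simp [evalR]
  | add p q hp hq => simp only [evalR, map_add, star_add] at *; rw [hp, hq]
  | mul_X p i hp =>
    simp only [evalR, map_mul, star_mul', eval_X, map_X] at *
    rw [hp]; simp

lemma dense_restr {n : ℕ} (K : Set (En n)) (hK : IsCompact K) :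
    Dense (Set.range (restr K)) := by
  have : CompactSpace K := isCompact_iff_compactSpace.mp hK
  let A : StarSubalgebra ℂ C(K, ℂ) :=
    { (restr K).range with
      star_mem' := by
        rintro _ ⟨Q, rfl⟩
        exact ⟨_, (restr_star K Q).symm⟩ }
  have hsep : A.SeparatesPoints := by
    intro x y hxy
    have : ∃ i, (x : En n) i ≠ (y : En n) i := by
      by_contra hcon
      push Not at hcon
      exact hxy (Subtype.ext (PiLp.ext hcon))
    obtain ⟨i, hi⟩ := this
    refine ⟨_, ⟨restr K (X i), ⟨X i, rfl⟩, rfl⟩, ?_⟩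
    simp only [restr_apply, evalR, eval_X]
    exact_mod_cast hi
  have h := ContinuousMap.starSubalgebra_topologicalClosure_eq_top_of_separatesPoints A hsep
  have h2 := StarSubalgebra.topologicalClosure_coe A
  rw [h] at h2
  have h3 : Dense (A : Set C(K, ℂ)) := by
    rw [dense_iff_closure_eq, ← h2]; rfl
  have h4 : (A : Set C(K, ℂ)) = Set.range (restr K) := by
    ext f; exact Iff.rfl
  rwa [h4] at h3

end PH

/-- The restrictions to `K_P(R)` of the polynomials `Q` with
`Δ^{N_P} Q = 0` form a dense subspace of `C(K_P(R), ℂ)`. -/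
theorem polyharmonic_polynomials_dense
    (n : ℕ) (hn : 2 ≤ n) (P : MvPolynomial (Fin n) ℂ) (hP : P ≠ 0)
    (NP : ℕ)
    (hNP : NP = sSup {d : ℕ | ∃ h : MvPolynomial (Fin n) ℂ,
      IsHarmonicPoly n h ∧ pdeg n (P * h) = d})
    (R : ℝ) (hR : 0 < R)
    (K : Set (En n)) (hK : K = {x : En n | evalR P x = 0 ∧ ‖x‖ ≤ R}) :
    Dense {f : C(K, ℂ) | ∃ Q : MvPolynomial (Fin n) ℂ,
      (lap n)^[NP] Q = 0 ∧ ∀ x : K, f x = evalR Q (x : En n)} := by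
  have hKc : IsCompact K := by
    apply Metric.isCompact_of_isClosed_isBounded
    · rw [hK]
      exact (isClosed_eq (PH.evalR_continuous P) continuous_const).inter
        (isClosed_le continuous_norm continuous_const)
    · rw [hK]
      refine (Metric.isBounded_closedBall (x := (0 : En n)) (r := R)).subset ?_
      intro x hx
      simpa using hx.2
  refine (PH.dense_restr K hKc).mono ?_
  rintro _ ⟨Q, rfl⟩
  obtain ⟨q, hq⟩ := PH.good_NP hn hP hNP Q
  refine ⟨Q - P * q, ?_, fun x => ?_⟩
  · rw [PH.lap_iter]; exact hq
  · have hx : evalR P (x : En n) = 0 := by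
      have h1 : ∀ y ∈ K, evalR P y = 0 := by
        intro y hy
        rw [hK] at hy
        exact hy.1
      exact h1 _ x.2
    rw [PH.restr_apply]
    simp only [evalR, map_sub, map_mul] at hx ⊢
    rw [hx, zero_mul, sub_zero]
end
end

section
/- Let μ be a finite signed measure on ℝⁿ (n ≥ 2) with support in the closed ball of radius R, and let R₁ > R. Then for every polynomial P on ℝⁿ, (1/(2πi)) ∮_{Γ_{R₁}} ∫_{S^{n-1}} P(ζθ) μ̂(ζ,θ) dθ dζ = ∫_{ℝⁿ} P(x) dμ(x). -/
open MeasureTheory Metric MvPolynomial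

noncomputable section

/-! ### Directional derivative and auxiliary polynomials -/

def DD {n : ℕ} (x : En n) : Derivation ℂ (MvPolynomial (Fin n) ℂ) (MvPolynomial (Fin n) ℂ) :=
  mkDerivation ℂ (fun i => C (x i : ℂ))

lemma der_sum {n : ℕ} (D : Fin n → Derivation ℂ (MvPolynomial (Fin n) ℂ) (MvPolynomial (Fin n) ℂ))
    (P : MvPolynomial (Fin n) ℂ) : (∑ i, D i) P = ∑ i, D i P := by
  have := map_sum (Derivation.coeFnAddMonoidHom (R := ℂ) (A := MvPolynomial (Fin n) ℂ)
    (M := MvPolynomial (Fin n) ℂ)) D Finset.univ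
  have := congrFun this P
  rw [Finset.sum_apply] at this
  exact this

lemma DD_eq {n : ℕ} (x : En n) (P : MvPolynomial (Fin n) ℂ) :
    DD x P = ∑ i, C (x i : ℂ) * pderiv i P := by
  have : DD x = ∑ i, (C (x i : ℂ) : MvPolynomial (Fin n) ℂ) • pderiv i := by
    apply MvPolynomial.derivation_ext
    intro j
    rw [der_sum]
    simp only [DD, mkDerivation_X, Derivation.smul_apply,
      pderiv_X, smul_eq_mul, Pi.single_apply]
    simp
  rw [this, der_sum]
  simp

lemma DD_C_mul {n : ℕ} (x : En n) (c : ℂ) (P : MvPolynomial (Fin n) ℂ) :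
    DD x (C c * P) = C c * DD x P := by
  rw [← smul_eq_C_mul, Derivation.map_smul, smul_eq_C_mul]

lemma DD_homog {n : ℕ} (x : En n) {P : MvPolynomial (Fin n) ℂ} {m : ℕ}
    (hP : P.IsHomogeneous (m + 1)) : (DD x P).IsHomogeneous m := by
  rw [DD_eq]
  refine IsHomogeneous.sum _ _ _ fun i _ => ?_
  exact (hP.pderiv (i := i)).C_mul _

lemma evalR_DD_self {n : ℕ} (x : En n) {P : MvPolynomial (Fin n) ℂ} {m : ℕ}
    (hP : P.IsHomogeneous m) : evalR (DD x P) x = m * evalR P x := by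
  have := congrArg (fun Q => evalR Q x) hP.sum_X_mul_pderiv
  simp only [evalR, map_sum, map_mul, eval_X, nsmul_eq_mul] at this
  rw [DD_eq]
  simp only [evalR, map_sum, map_mul, eval_C]
  simpa using this

/-- linear form `⟨x, ·⟩` -/
def TT {n : ℕ} (x : En n) : MvPolynomial (Fin n) ℂ := ∑ i, C (x i : ℂ) * X i
/-- `|·|^2` -/
def NN (n : ℕ) : MvPolynomial (Fin n) ℂ := ∑ i, X i * X i
/-- `|x|^2` -/
def XX {n : ℕ} (x : En n) : ℂ := ∑ i, (x i : ℂ) * (x i : ℂ)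

lemma TT_homog {n : ℕ} (x : En n) : (TT x).IsHomogeneous 1 :=
  IsHomogeneous.sum _ _ _ fun i _ => (isHomogeneous_X ℂ i).C_mul _

lemma NN_homog (n : ℕ) : (NN n).IsHomogeneous 2 :=
  IsHomogeneous.sum _ _ _ fun i _ => (isHomogeneous_X ℂ i).mul (isHomogeneous_X ℂ i)

lemma DD_TT {n : ℕ} (x : En n) : DD x (TT x) = C (XX x) := by
  simp only [TT, XX, map_sum, DD_C_mul]
  simp [DD, mkDerivation_X]

lemma DD_NN {n : ℕ} (x : En n) : DD x (NN n) = 2 * TT x := by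
  simp only [TT, NN, map_sum, Derivation.leibniz, DD, mkDerivation_X, Finset.mul_sum]
  refine Finset.sum_congr rfl fun i _ => ?_
  simp only [smul_eq_mul]; ring

lemma evalR_TT {n : ℕ} (x y : En n) : evalR (TT x) y = ((inner ℝ y x : ℝ) : ℂ) := by
  simp [evalR, TT, PiLp.inner_apply]

lemma evalR_NN {n : ℕ} (y : En n) : evalR (NN n) y = ((‖y‖ : ℝ) : ℂ) ^ 2 := by
  rw [← Complex.ofReal_pow, EuclideanSpace.norm_sq_eq]
  simp [evalR, NN, sq]

lemma XX_eq {n : ℕ} (x : En n) : XX x = ((‖x‖ : ℝ) : ℂ) ^ 2 := by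
  rw [← Complex.ofReal_pow, EuclideanSpace.norm_sq_eq]
  simp [XX, sq]

lemma evalR_mul {n : ℕ} (P Q : MvPolynomial (Fin n) ℂ) (x : En n) :
    evalR (P * Q) x = evalR P x * evalR Q x := by simp [evalR]
lemma evalR_C {n : ℕ} (c : ℂ) (x : En n) :
    evalR (C c) x = c := by simp [evalR]
lemma evalR_add {n : ℕ} (P Q : MvPolynomial (Fin n) ℂ) (x : En n) :
    evalR (P + Q) x = evalR P x + evalR Q x := by simp [evalR]
lemma evalR_sub {n : ℕ} (P Q : MvPolynomial (Fin n) ℂ) (x : En n) :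
    evalR (P - Q) x = evalR P x - evalR Q x := by simp [evalR]

/-- Gegenbauer-type polynomials -/
def GG {n : ℕ} (x : En n) : ℕ → MvPolynomial (Fin n) ℂ
  | 0 => 1
  | 1 => C (n : ℂ) * TT x
  | (k + 2) => C ((k + 2 : ℂ)⁻¹) * (C (2 * k + 2 + n : ℂ) * (TT x * GG x (k + 1))
      - C ((k + n : ℂ) * XX x) * (NN n * GG x k))

lemma GG_rec {n : ℕ} (x : En n) (k : ℕ) :
    C (k + 2 : ℂ) * GG x (k + 2) = C (2 * k + 2 + n : ℂ) * (TT x * GG x (k + 1))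
      - C ((k + n : ℂ) * XX x) * (NN n * GG x k) := by
  have h : (k + 2 : ℂ) ≠ 0 := by
    have : ((k + 2 : ℕ) : ℂ) ≠ 0 := by exact_mod_cast (by omega : k + 2 ≠ 0)
    simpa using this
  rw [GG, ← mul_assoc, ← C_mul, mul_inv_cancel₀ h, C_1, one_mul]

lemma GG_homog {n : ℕ} (x : En n) (k : ℕ) : (GG x k).IsHomogeneous k ∧
    (GG x (k + 1)).IsHomogeneous (k + 1) := by
  induction k with
  | zero =>
    refine ⟨by simpa [GG] using isHomogeneous_one _ _, ?_⟩
    simpa [GG] using (TT_homog x).C_mul (n : ℂ)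
  | succ k ih =>
    refine ⟨ih.2, ?_⟩
    rw [GG]
    refine IsHomogeneous.C_mul (IsHomogeneous.sub (IsHomogeneous.C_mul ?_ _)
      (IsHomogeneous.C_mul ?_ _)) _
    · exact (show 1 + (k + 1) = k + 1 + 1 by omega) ▸ (TT_homog x).mul ih.2
    · exact (show 2 + k = k + 1 + 1 by omega) ▸ (NN_homog n).mul ih.1

lemma DD_mul {n : ℕ} (x : En n) (P Q : MvPolynomial (Fin n) ℂ) :
    DD x (P * Q) = P * DD x Q + Q * DD x P := by
  rw [Derivation.leibniz]; rfl

lemma C_cancel {n : ℕ} (c : ℂ) (hc : c ≠ 0) {P Q : MvPolynomial (Fin n) ℂ}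
    (h : C c * P = C c * Q) : P = Q := by
  have := congrArg (fun z => C (c⁻¹) * z) h
  simpa [← mul_assoc, ← C_mul, hc] using this

lemma DD_GG {n : ℕ} (x : En n) (k : ℕ) :
    DD x (GG x (k + 1)) = C ((k + n : ℂ) * XX x) * GG x k := by
  suffices h : ∀ k : ℕ, DD x (GG x (k + 1)) = C ((k + n : ℂ) * XX x) * GG x k ∧
     DD x (GG x (k + 2)) = C (((k + 1 : ℕ) + n : ℂ) * XX x) * GG x (k + 1) from (h k).1
  clear k
  intro k
  have key : ∀ k : ℕ, DD x (GG x (k + 2)) * C (k + 2 : ℂ) =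
     C (2 * k + 2 + n : ℂ) * (TT x * DD x (GG x (k + 1)) + GG x (k + 1) * C (XX x))
      - C ((k + n : ℂ) * XX x) * (NN n * DD x (GG x k) + GG x k * (2 * TT x)) := by
    intro k
    rw [mul_comm, ← DD_C_mul, GG_rec, map_sub, DD_C_mul, DD_C_mul, DD_mul, DD_mul, DD_TT, DD_NN]
  have nz : ∀ k : ℕ, (k + 2 : ℂ) ≠ 0 := fun k => by
    have : ((k + 2 : ℕ) : ℂ) ≠ 0 := by exact_mod_cast (by omega : k + 2 ≠ 0)
    simpa using this
  induction k with
  | zero =>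
    have h1 : DD x (GG x 1) = C ((n : ℂ) * XX x) * GG x 0 := by
      simp only [GG]; rw [DD_C_mul, DD_TT, C_mul, mul_one]
    refine ⟨by simpa using h1, ?_⟩
    apply C_cancel _ (nz 0)
    rw [mul_comm, key 0]
    rw [zero_add, h1]
    have h0 : DD x (GG x 0) = 0 := by simp [GG]
    rw [h0]
    simp only [GG, map_mul, map_add, map_ofNat, map_one, Nat.cast_zero, C_0, Nat.cast_one,
      zero_add, map_natCast]
    simp
    ring
  | succ k ih =>
    refine ⟨ih.2, ?_⟩
    apply C_cancel _ (nz (k + 1))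
    rw [mul_comm, key (k + 1), ih.1, ih.2]
    have r := GG_rec x k
    simp only [map_mul, map_add, map_ofNat, map_one, map_natCast, Nat.cast_add, Nat.cast_one]
      at r ⊢
    linear_combination (C (XX x)) * ((k:MvPolynomial (Fin n) ℂ) + 1 + n) * (-r)

/-! ### Polar coordinates and integration by parts on the sphere -/

lemma evalC_homog {n : ℕ} {f : MvPolynomial (Fin n) ℂ} {m : ℕ} (hf : f.IsHomogeneous m)
    (r : ℂ) (y : En n) : evalC f r y = r ^ m * evalR f y := by
  rw [evalC, evalR, eval_eq', eval_eq', Finset.mul_sum]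
  refine Finset.sum_congr rfl fun d hd => ?_
  have h : ∑ i, d i = m := by
    have := hf (mem_support_iff.1 hd)
    rw [Finsupp.weight_apply, Finsupp.sum_fintype] at this <;> simp_all
  simp_rw [mul_pow]
  rw [Finset.prod_mul_distrib, Finset.prod_pow_eq_pow_sum, h]
  ring

lemma evalR_smul {n : ℕ} {f : MvPolynomial (Fin n) ℂ} {m : ℕ} (hf : f.IsHomogeneous m)
    (r : ℝ) (y : En n) : evalR f (r • y) = (r : ℂ) ^ m * evalR f y := by
  rw [← evalC_homog hf]
  simp [evalR, evalC]

lemma evalR_continuous_s2 {n : ℕ} (f : MvPolynomial (Fin n) ℂ) : Continuous (evalR f) := by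
  unfold evalR
  have := MvPolynomial.continuous_eval f
  fun_prop

lemma evalR_hasFDerivAt {n : ℕ} (f : MvPolynomial (Fin n) ℂ) (y v : En n) :
    HasLineDerivAt ℝ (evalR f) (evalR (DD v f) y) y v := by
  unfold HasLineDerivAt
  induction f using MvPolynomial.induction_on with
  | C a =>
    have : DD v (C a) = 0 := by simp
    simp only [this, evalR_C]
    simpa [evalR] using hasDerivAt_const (0 : ℝ) a
  | add p q hp hq =>
    simp only [map_add, evalR_add]
    exact hp.add hq
  | mul_X p i hp =>
    have hX : HasDerivAt (fun t : ℝ => evalR (X i) (y + t • v)) (v i : ℂ) 0 := by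
      simp only [evalR, eval_X, PiLp.add_apply, PiLp.smul_apply, smul_eq_mul]
      have := (((hasDerivAt_id (0 : ℝ)).mul_const (v i)).const_add (y i)).ofReal_comp
      simpa using this
    have := hp.mul hX
    simp only [evalR_mul, DD_mul, evalR_add] at this ⊢
    refine this.congr_deriv ?_
    simp [DD, mkDerivation_X, evalR]
    ring

def cc (a : ℕ) : ℝ := ∫ r in Set.Ioi (0 : ℝ), r ^ a * Real.exp (-r ^ 2)

lemma cc_eq (a : ℕ) : cc a = (1 / 2) * Real.Gamma ((a + 1) / 2) := by
  have := integral_rpow_mul_exp_neg_rpow (p := 2) (q := a) (by norm_num)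
    (by have : (0 : ℝ) ≤ a := by positivity
        linarith)
  rw [← this, cc]
  simp

lemma cc_pos (a : ℕ) : 0 < cc a := by
  rw [cc_eq]
  have := Real.Gamma_pos_of_pos (s := ((a : ℝ) + 1) / 2) (by positivity)
  positivity

lemma cc_succ (a : ℕ) : 2 * cc (a + 2) = (a + 1) * cc a := by
  rw [cc_eq, cc_eq]
  have h := Real.Gamma_add_one (s := ((a : ℝ) + 1) / 2) (by positivity)
  have e : (((a + 2 : ℕ) : ℝ) + 1) / 2 = ((a : ℝ) + 1) / 2 + 1 := by push_cast; ring
  rw [e, h]; ring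

lemma cc_integrable (a : ℕ) :
    IntegrableOn (fun r : ℝ => r ^ a * Real.exp (-r ^ 2)) (Set.Ioi 0) := by
  by_contra h
  have := cc_pos a
  rw [cc, integral_undef h] at this
  exact lt_irrefl _ this

instance sphereMeasure_finite (n : ℕ) : IsFiniteMeasure (sphereMeasure n) := by
  unfold sphereMeasure; infer_instance

lemma polar {n : ℕ} (hn : 2 ≤ n) {f : MvPolynomial (Fin n) ℂ} {m : ℕ} (hf : f.IsHomogeneous m) :
    Integrable (fun y : En n => evalR f y * (Real.exp (-‖y‖ ^ 2) : ℂ)) ∧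
    ∫ y : En n, evalR f y * (Real.exp (-‖y‖ ^ 2) : ℂ) =
      (∫ θ : sphere (0 : En n) 1, evalR f (θ : En n) ∂(sphereMeasure n)) * (cc (m + (n - 1)) : ℂ) := by
  have hd : Module.finrank ℝ (En n) = n := by simp
  have hmp := (volume : Measure (En n)).measurePreserving_homeomorphUnitSphereProd
  rw [hd] at hmp
  set F : sphere (0 : En n) 1 × Set.Ioi (0 : ℝ) → ℂ :=
    fun p => evalR f (p.1 : En n) * (((p.2 : ℝ) ^ m * Real.exp (-(p.2 : ℝ) ^ 2) : ℝ) : ℂ) with hF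
  have hcomp : ∀ y : ({0}ᶜ : Set (En n)), F (homeomorphUnitSphereProd (En n) y) =
      evalR f y * (Real.exp (-‖(y : En n)‖ ^ 2) : ℂ) := by
    intro y
    have hy : ‖(y : En n)‖ ≠ 0 := norm_ne_zero_iff.2 y.2
    simp only [hF, homeomorphUnitSphereProd_apply_snd_coe, homeomorphUnitSphereProd_apply_fst_coe]
    rw [evalR_smul hf]
    have hy' : ((‖(y : En n)‖ : ℝ) : ℂ) ≠ 0 := by exact_mod_cast hy
    push_cast
    rw [inv_pow]
    field_simp
  have hI2 : Integrable (fun r : Set.Ioi (0 : ℝ) =>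
      (((r : ℝ) ^ m * Real.exp (-(r : ℝ) ^ 2) : ℝ) : ℂ)) (Measure.volumeIoiPow (n - 1)) := by
    apply Integrable.ofReal
    have := cc_integrable (m + (n - 1))
    rw [integrableOn_iff_comap_subtypeVal measurableSet_Ioi] at this
    rw [Measure.volumeIoiPow]
    rw [integrable_withDensity_iff (by fun_prop) (by simp)]
    refine this.congr (Filter.Eventually.of_forall fun r => ?_)
    have : (0 : ℝ) ≤ (r : ℝ) ^ (n - 1) := pow_nonneg (le_of_lt r.2) _
    simp only [Function.comp, ENNReal.toReal_ofReal this, pow_add]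
    exact mul_right_comm _ _ _
  have hI1 : Integrable (fun θ : sphere (0 : En n) 1 => evalR f (θ : En n)) (sphereMeasure n) := by
    exact ((evalR_continuous_s2 f).comp continuous_subtype_val).integrable_of_hasCompactSupport
      (HasCompactSupport.of_compactSpace _)
  have hFI : Integrable F ((sphereMeasure n).prod (Measure.volumeIoiPow (n - 1))) := hI1.mul_prod hI2
  have hv : ∫ r : Set.Ioi (0 : ℝ), (((r : ℝ) ^ m * Real.exp (-(r : ℝ) ^ 2) : ℝ) : ℂ)
      ∂(Measure.volumeIoiPow (n - 1)) = (cc (m + (n - 1)) : ℂ) := by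
    refine integral_ofReal.trans (congrArg Complex.ofReal ?_)
    rw [Measure.volumeIoiPow, cc, ← integral_subtype_comap measurableSet_Ioi]
    rw [integral_withDensity_eq_integral_toReal_smul (by fun_prop) (by simp)]
    refine integral_congr_ae (Filter.Eventually.of_forall fun r => ?_)
    have : (0 : ℝ) ≤ (r : ℝ) ^ (n - 1) := pow_nonneg (le_of_lt r.2) _
    simp only [smul_eq_mul, ENNReal.toReal_ofReal this, pow_add]
    refine Eq.trans ?_ (show (r : ℝ) ^ (n - 1) * ((r : ℝ) ^ m * Real.exp (-(r : ℝ) ^ 2)) = _ by ring)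
    rfl
  have hemb := (homeomorphUnitSphereProd (En n)).measurableEmbedding
  constructor
  · have : Nontrivial (En n) := by
      apply Module.nontrivial_of_finrank_pos (R := ℝ); rw [hd]; omega
    rw [← restrict_compl_singleton (μ := (volume : Measure (En n))) 0, ← IntegrableOn,
      integrableOn_iff_comap_subtypeVal (by measurability)]
    refine ((hmp.integrable_comp_emb hemb).2 hFI).congr (Filter.Eventually.of_forall fun y => ?_)
    exact hcomp y
  · have : Nontrivial (En n) := by
      apply Module.nontrivial_of_finrank_pos (R := ℝ); rw [hd]; omega
    calc _ = ∫ y : ({0}ᶜ : Set (En n)), evalR f y * (Real.exp (-‖(y : En n)‖ ^ 2) : ℂ)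
          ∂((volume : Measure (En n)).comap (↑)) := by
          rw [integral_subtype_comap (measurableSet_singleton _).compl
            fun y : En n => evalR f y * (Real.exp (-‖y‖ ^ 2) : ℂ), restrict_compl_singleton]
      _ = ∫ y : ({0}ᶜ : Set (En n)), F (homeomorphUnitSphereProd (En n) y)
          ∂((volume : Measure (En n)).comap (↑)) := by simp_rw [hcomp]
      _ = ∫ p, F p ∂((sphereMeasure n).prod (Measure.volumeIoiPow (n - 1))) :=
          hmp.integral_comp hemb F
      _ = _ := by 
          rw [← hv]
          exact integral_prod_mul (fun θ : sphere (0 : En n) 1 => evalR f (θ : En n))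
            (fun r : Set.Ioi (0 : ℝ) => (((r : ℝ) ^ m * Real.exp (-(r : ℝ) ^ 2) : ℝ) : ℂ))

lemma sphere_div {n : ℕ} (hn : 2 ≤ n) (x : En n) {f : MvPolynomial (Fin n) ℂ} {m : ℕ}
    (hf : f.IsHomogeneous (m + 1)) :
    ∫ θ : sphere (0 : En n) 1, evalR (DD x f) (θ : En n) ∂(sphereMeasure n) =
    (m + n) * ∫ θ : sphere (0 : En n) 1, evalR (TT x * f) (θ : En n) ∂(sphereMeasure n) := by
  obtain ⟨i1, e1⟩ := polar hn (DD_homog x hf)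
  obtain ⟨i2, e2⟩ := polar hn hf
  obtain ⟨i3, e3⟩ := polar hn ((TT_homog x).mul hf)
  have hg : ∀ y : En n, HasLineDerivAt ℝ (fun y : En n => (Real.exp (-‖y‖ ^ 2) : ℂ))
      (-2 * evalR (TT x) y * (Real.exp (-‖y‖ ^ 2) : ℂ)) y x := by
    intro y
    unfold HasLineDerivAt
    have hq : HasDerivAt (fun t : ℝ => ‖y + t • x‖ ^ 2) (2 * inner ℝ y x) 0 := by
      have h1 : HasDerivAt (fun t : ℝ => y + t • x) x 0 := by
        simpa using ((hasDerivAt_id (0 : ℝ)).smul_const x).const_add y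
      simpa using h1.norm_sq
    have := (hq.neg.exp).ofReal_comp
    refine this.congr_deriv ?_
    rw [evalR_TT]
    simp
    ring
  have := integral_bilinear_hasLineDerivAt_right_eq_neg_left_of_integrable
    (μ := (volume : Measure (En n))) (f := evalR f) (f' := evalR (DD x f))
    (g := fun y : En n => (Real.exp (-‖y‖ ^ 2) : ℂ))
    (g' := fun y => -2 * evalR (TT x) y * (Real.exp (-‖y‖ ^ 2) : ℂ)) (v := x)
    (B := ContinuousLinearMap.mul ℝ ℂ) i1
    (by
      refine (i3.const_mul (-2)).congr (Filter.Eventually.of_forall fun y => ?_)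
      simp only [evalR_mul, ContinuousLinearMap.mul_apply']
      ring) i2 (fun y _ => evalR_hasFDerivAt f y x) (fun y _ => hg y)
  simp only [ContinuousLinearMap.mul_apply'] at this
  have h2 : ∫ y : En n, evalR f y * (-2 * evalR (TT x) y * (Real.exp (-‖y‖ ^ 2) : ℂ)) =
     -2 * ∫ y : En n, evalR (TT x * f) y * (Real.exp (-‖y‖ ^ 2) : ℂ) := by
    rw [← integral_const_mul]
    congr 1; ext y; rw [evalR_mul]; ring
  rw [h2, e3, e1] at this
  have c1 : (cc (m + (n - 1)) : ℂ) ≠ 0 := by exact_mod_cast (cc_pos _).ne'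
  have hc := cc_succ (m + (n - 1))
  have hc' : 2 * (cc (m + (n - 1) + 2) : ℂ) = (m + n) * cc (m + (n - 1)) := by
    have : (((m + (n - 1) : ℕ) : ℝ) + 1) = m + n := by
      rw [← Nat.cast_add, ← Nat.cast_add_one]; congr 1; omega
    rw [this] at hc
    exact_mod_cast hc
  have e : 1 + (m + 1) + (n - 1) = m + (n - 1) + 2 := by omega
  rw [e] at this
  apply mul_right_cancel₀ c1
  linear_combination this + (∫ θ : sphere (0 : En n) 1, evalR (TT x * f) (θ : En n) ∂(sphereMeasure n)) * hc'

/-! ### The reproducing property -/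

lemma sphere_integrable {n : ℕ} (f : MvPolynomial (Fin n) ℂ) :
    Integrable (fun θ : sphere (0 : En n) 1 => evalR f (θ : En n)) (sphereMeasure n) :=
  ((evalR_continuous_s2 f).comp continuous_subtype_val).integrable_of_hasCompactSupport
      (HasCompactSupport.of_compactSpace _)

lemma GG_step {n : ℕ} (x θ : En n) (hθ : ‖θ‖ = 1) (k : ℕ) :
    (k + 1) * evalR (GG x (k + 1)) θ =
      (2 * k + n) * (evalR (TT x) θ * evalR (GG x k) θ) - evalR (DD x (GG x k)) θ := by
  cases k with
  | zero => simp [GG, evalR]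
  | succ k =>
    have h := congrArg (fun Q => evalR Q θ) (GG_rec x k)
    simp only [evalR_mul, evalR_sub, evalR_C, evalR_NN, hθ] at h
    rw [DD_GG, evalR_mul, evalR_C]
    push_cast at h ⊢
    linear_combination h

lemma reproduce {n : ℕ} (hn : 2 ≤ n) (x : En n) (k : ℕ) :
    ∀ P : MvPolynomial (Fin n) ℂ, P.IsHomogeneous k →
    ∫ θ : sphere (0 : En n) 1, evalR P (θ : En n) * evalR (GG x k) (θ : En n) ∂(sphereMeasure n) =
      evalR P x * omegaN n := by
  induction k with
  | zero =>
    intro P hP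
    have h0 : ∀ y, evalR P y = evalR P 0 := fun y => by
      have := evalR_smul hP 0 y
      simpa using this.symm
    have h1 : ∀ y, evalR (GG x 0) y = 1 := fun y => by simp [GG, evalR]
    simp_rw [h1, h0 x]
    simp_rw [fun θ : sphere (0 : En n) 1 => h0 (θ : En n)]
    simp [omegaN, Measure.real, mul_comm]
  | succ k ih =>
    intro P hP
    have hf : (P * GG x k).IsHomogeneous (2 * k + 1) := by
      exact (show (k + 1) + k = 2 * k + 1 by omega) ▸ hP.mul (GG_homog x k).1
    have hdiv := sphere_div hn x hf
    have hih := ih _ (DD_homog x hP)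
    rw [evalR_DD_self x hP] at hih
    have hs : ∫ θ : sphere (0 : En n) 1, evalR (DD x (P * GG x k)) (θ : En n) ∂(sphereMeasure n)
        = ∫ θ : sphere (0 : En n) 1, evalR (P * DD x (GG x k)) (θ : En n) ∂(sphereMeasure n)
        + ∫ θ : sphere (0 : En n) 1, evalR (DD x P) (θ : En n) * evalR (GG x k) (θ : En n)
          ∂(sphereMeasure n) := by
      have hi := sphere_integrable (DD x P * GG x k)
      simp only [evalR_mul] at hi
      rw [← integral_add (sphere_integrable _) hi]
      congr 1; ext θ
      simp only [DD_mul, evalR_add, evalR_mul]; ring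
    have hm : (k + 1 : ℂ) * ∫ θ : sphere (0 : En n) 1, evalR P (θ : En n) *
          evalR (GG x (k + 1)) (θ : En n) ∂(sphereMeasure n) =
        (2 * k + n) * ∫ θ : sphere (0 : En n) 1, evalR (TT x * (P * GG x k)) (θ : En n)
          ∂(sphereMeasure n)
        - ∫ θ : sphere (0 : En n) 1, evalR (P * DD x (GG x k)) (θ : En n) ∂(sphereMeasure n) := by
      rw [← integral_const_mul, ← integral_const_mul,
        ← integral_sub ((sphere_integrable _).const_mul _) (sphere_integrable _)]
      congr 1; ext θ
      have := GG_step x (θ : En n) (by simpa using θ.2) k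
      simp only [evalR_mul]
      linear_combination evalR P (θ : En n) * this
    have hk : (k + 1 : ℂ) ≠ 0 := by exact_mod_cast Nat.succ_ne_zero k
    apply mul_left_cancel₀ hk
    push_cast at hdiv hih
    rw [hm]
    linear_combination hs - hdiv + hih

/-! ### The one-variable contour integrals -/

lemma circle_inv {g : ℂ → ℂ} {r : ℝ} (hr : 0 < r)
    (hg : ∀ z ∈ closedBall (0 : ℂ) r⁻¹, DifferentiableAt ℂ g z) :
    (∮ ζ in C(0, r), ζ⁻¹ * g ζ⁻¹) = 2 * Real.pi * Complex.I * g 0 := by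
  have hav : Real.circleAverage g 0 r⁻¹ = g 0 := by
    apply circleAverage_of_differentiable_on_off_countable Set.countable_empty
    · rw [abs_of_pos (inv_pos.2 hr)]
      exact fun z hz => (hg z hz).continuousAt.continuousWithinAt
    · rw [abs_of_pos (inv_pos.2 hr)]
      exact fun z hz => hg z (ball_subset_closedBall hz.1)
  rw [Real.circleAverage] at hav
  have hper : Function.Periodic (fun θ => g (circleMap 0 r⁻¹ θ)) (2 * Real.pi) :=
    (periodic_circleMap 0 r⁻¹).comp g
  have e1 : (∫ θ in (0 : ℝ)..2 * Real.pi, g (circleMap 0 r⁻¹ (-θ))) =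
      ∫ θ in (0 : ℝ)..2 * Real.pi, g (circleMap 0 r⁻¹ θ) := by
    rw [intervalIntegral.integral_comp_neg (fun θ => g (circleMap 0 r⁻¹ θ))]
    have := hper.intervalIntegral_add_eq (-(2 * Real.pi)) 0
    simpa using this
  have e2 : (∮ ζ in C(0, r), ζ⁻¹ * g ζ⁻¹) =
      Complex.I * ∫ θ in (0 : ℝ)..2 * Real.pi, g (circleMap 0 r⁻¹ (-θ)) := by
    rw [circleIntegral, ← intervalIntegral.integral_const_mul]
    congr 1; ext θ
    have hne : circleMap 0 r θ ≠ 0 := circleMap_ne_center hr.ne'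
    have hi : (circleMap 0 r θ)⁻¹ = circleMap 0 r⁻¹ (-θ) := by
      simp [circleMap, Complex.exp_neg, mul_comm]
    rw [deriv_circleMap, smul_eq_mul, hi, ← hi]
    field_simp
  rw [e2, e1, ← hav]
  simp only [Complex.real_smul]
  have : (Real.pi : ℂ) ≠ 0 := by exact_mod_cast Real.pi_ne_zero
  push_cast
  field_simp

lemma mem_slit_mul {u v : ℂ} (hu : 0 < u.re) (hv : 0 < v.re) : u * v ∈ Complex.slitPlane := by
  rw [Complex.mem_slitPlane_iff]
  by_contra! h
  obtain ⟨h1, h2⟩ := h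
  rw [Complex.mul_re] at h1
  rw [Complex.mul_im] at h2
  have : u.re * (u.re * v.re - u.im * v.im) = (u.re ^ 2 + u.im ^ 2) * v.re := by
    linear_combination (-u.im) * h2
  have h3 : 0 < (u.re ^ 2 + u.im ^ 2) * v.re := by positivity
  nlinarith

lemma mem_slit {t N : ℝ} (ht : t ^ 2 ≤ N ^ 2) (hN : 0 ≤ N) {s : ℂ} (hs : ‖s‖ * N < 1) :
    1 - 2 * (t : ℂ) * s + (N : ℂ) ^ 2 * s ^ 2 ∈ Complex.slitPlane := by
  set a : ℂ := ⟨t, Real.sqrt (N ^ 2 - t ^ 2)⟩ with ha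
  have hsq : Real.sqrt (N ^ 2 - t ^ 2) ^ 2 = N ^ 2 - t ^ 2 := Real.sq_sqrt (by linarith)
  have hna : ‖a‖ = N := by
    rw [← Real.sqrt_sq hN, Complex.norm_def]
    congr 1
    rw [Complex.normSq_apply, ha]
    linear_combination hsq
  have hprod : a * (starRingEnd ℂ) a = (N : ℂ) ^ 2 := by
    rw [Complex.mul_conj, Complex.normSq_eq_norm_sq, hna]; push_cast; rfl
  have hsum : a + (starRingEnd ℂ) a = 2 * t := by
    rw [Complex.add_conj, ha]; push_cast; rfl
  have : 1 - 2 * (t : ℂ) * s + (N : ℂ) ^ 2 * s ^ 2 = (1 - a * s) * (1 - (starRingEnd ℂ) a * s) := by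
    linear_combination s * hsum - s ^ 2 * hprod
  rw [this]
  have hre : ∀ b : ℂ, ‖b‖ = N → 0 < (1 - b * s).re := by
    intro b hb
    have h1 : (b * s).re ≤ ‖b * s‖ := Complex.re_le_norm _
    rw [norm_mul, hb] at h1
    rw [Complex.sub_re, Complex.one_re]
    nlinarith
  exact mem_slit_mul (hre a hna) (hre _ (by rw [RCLike.norm_conj, hna]))

section coeffs

variable {n : ℕ} {t N r : ℝ}

/-- the Markov kernel -/
def KK (n : ℕ) (t N : ℝ) (ζ : ℂ) : ℂ :=
  ζ⁻¹ * (1 - 2 * (t : ℂ) * ζ⁻¹ + (N : ℂ) ^ 2 * ζ⁻¹ ^ 2) ^ (-((n : ℂ) / 2))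

lemma ww_slit (ht : t ^ 2 ≤ N ^ 2) (hN : 0 ≤ N) (hr : N < r) {ζ : ℂ} (hζ : ‖ζ‖ = r) :
    1 - 2 * (t : ℂ) * ζ⁻¹ + (N : ℂ) ^ 2 * ζ⁻¹ ^ 2 ∈ Complex.slitPlane := by
  apply mem_slit ht hN
  rw [norm_inv, hζ, inv_mul_lt_one₀ (by linarith)]
  exact hr

lemma KK_deriv (ht : t ^ 2 ≤ N ^ 2) (hN : 0 ≤ N) (hr : N < r) {ζ : ℂ} (hζ : ‖ζ‖ = r) :
    HasDerivAt (KK n t N) (KK n t N ζ * (-ζ⁻¹ - (n / 2) * (2 * t * ζ⁻¹ ^ 2 - 2 * N ^ 2 * ζ⁻¹ ^ 3) /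
      (1 - 2 * (t : ℂ) * ζ⁻¹ + (N : ℂ) ^ 2 * ζ⁻¹ ^ 2))) ζ := by
  have hs := ww_slit ht hN hr hζ
  have h0 : ζ ≠ 0 := by
    rw [← norm_pos_iff, hζ]; linarith
  have hi := hasDerivAt_inv h0
  have hw : HasDerivAt (fun ζ : ℂ => 1 - 2 * (t : ℂ) * ζ⁻¹ + (N : ℂ) ^ 2 * ζ⁻¹ ^ 2)
      (2 * t * ζ⁻¹ ^ 2 - 2 * N ^ 2 * ζ⁻¹ ^ 3) ζ := by
    have := ((hi.const_mul (2 * (t : ℂ))).const_sub 1).add ((hi.pow 2).const_mul ((N : ℂ) ^ 2))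
    refine this.congr_deriv ?_
    simp only [Nat.add_one_sub_one, pow_one]
    push_cast
    ring
  have := hi.mul (hw.cpow_const (c := -((n : ℂ) / 2)) hs)
  refine this.congr_deriv ?_
  have hw0 := Complex.slitPlane_ne_zero hs
  rw [Complex.cpow_sub _ _ hw0, Complex.cpow_one, KK]
  set w := 1 - 2 * (t : ℂ) * ζ⁻¹ + (N : ℂ) ^ 2 * ζ⁻¹ ^ 2 with hwd
  clear_value w
  field_simp
  ring

lemma KK_q_deriv (ht : t ^ 2 ≤ N ^ 2) (hN : 0 ≤ N) (hr : N < r) {ζ : ℂ} (hζ : ‖ζ‖ = r) :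
    HasDerivAt (fun ζ : ℂ => (ζ ^ 2 - 2 * t * ζ + N ^ 2) * KK n t N ζ)
      (KK n t N ζ * (ζ - n * t + (n - 1) * N ^ 2 * ζ⁻¹)) ζ := by
  have h0 : ζ ≠ 0 := by
    rw [← norm_pos_iff, hζ]; linarith
  have hw0 := Complex.slitPlane_ne_zero (ww_slit ht hN hr hζ)
  have hq : HasDerivAt (fun ζ : ℂ => ζ ^ 2 - 2 * t * ζ + (N : ℂ) ^ 2) (2 * ζ - 2 * t) ζ := by
    have := (((hasDerivAt_id ζ).pow 2).sub ((hasDerivAt_id ζ).const_mul (2 * (t : ℂ)))).add_const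
      ((N : ℂ) ^ 2)
    refine this.congr_deriv ?_
    simp
  refine (hq.mul (KK_deriv (n := n) ht hN hr hζ)).congr_deriv ?_
  set w := 1 - 2 * (t : ℂ) * ζ⁻¹ + (N : ℂ) ^ 2 * ζ⁻¹ ^ 2 with hwd
  have hqw : ζ ^ 2 - 2 * t * ζ + (N : ℂ) ^ 2 = ζ ^ 2 * w := by
    rw [hwd]; field_simp
  have e : (ζ ^ 2 * w) * (-ζ⁻¹ - (n / 2) * (2 * t * ζ⁻¹ ^ 2 - 2 * N ^ 2 * ζ⁻¹ ^ 3) / w)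
      = - ζ * w - n * (t - N ^ 2 * ζ⁻¹) := by
    clear_value w
    field_simp
  have e2 : ζ * w = ζ - 2 * t + N ^ 2 * ζ⁻¹ := by rw [hwd]; field_simp
  rw [hqw]
  linear_combination (KK n t N ζ) * e - (KK n t N ζ) * e2

lemma KK_int (ht : t ^ 2 ≤ N ^ 2) (hN : 0 ≤ N) (hr : N < r) {g : ℂ → ℂ}
    (hg : ContinuousOn g (sphere 0 r)) :
    CircleIntegrable (fun ζ => g ζ * KK n t N ζ) 0 r := by
  apply ContinuousOn.circleIntegrable (by linarith)
  apply hg.mul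
  intro ζ hζ
  exact (KK_deriv ht hN hr (by simpa using hζ)).continuousAt.continuousWithinAt

/-- the moments -/
def bb (n : ℕ) (t N r : ℝ) (k : ℕ) : ℂ := ∮ ζ in C(0, r), ζ ^ k * KK n t N ζ

lemma PhiDiff (ht : t ^ 2 ≤ N ^ 2) (hN : 0 ≤ N) (hr : N < r) (z : ℂ)
    (hz : z ∈ closedBall (0 : ℂ) r⁻¹) : DifferentiableAt ℂ
      (fun s : ℂ => (1 - 2 * (t : ℂ) * s + (N : ℂ) ^ 2 * s ^ 2) ^ (-((n : ℂ) / 2))) z := by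
  apply DifferentiableAt.cpow_const (by fun_prop)
  apply mem_slit ht hN
  have hr0 : 0 < r := by linarith
  have : ‖z‖ ≤ r⁻¹ := by simpa using hz
  calc ‖z‖ * N ≤ r⁻¹ * N := by gcongr
    _ < 1 := by rw [inv_mul_lt_one₀ hr0]; exact hr

lemma bb_zero (ht : t ^ 2 ≤ N ^ 2) (hN : 0 ≤ N) (hr : N < r) :
    bb n t N r 0 = 2 * Real.pi * Complex.I := by
  have := circle_inv (by linarith) (PhiDiff (n := n) ht hN hr)
  simp only [bb, KK, pow_zero, one_mul]
  rw [this]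
  simp

lemma bb_neg (ht : t ^ 2 ≤ N ^ 2) (hN : 0 ≤ N) (hr : N < r) :
    (∮ ζ in C(0, r), ζ⁻¹ * KK n t N ζ) = 0 := by
  have := circle_inv (g := fun s : ℂ => s *
    (1 - 2 * (t : ℂ) * s + (N : ℂ) ^ 2 * s ^ 2) ^ (-((n : ℂ) / 2))) (r := r) (by linarith)
    (fun z hz => differentiableAt_id.mul (PhiDiff (n := n) ht hN hr z hz))
  simp only [KK]
  rw [this]
  simp

lemma inv_cont (hr : 0 < r) : ContinuousOn (fun ζ : ℂ => ζ⁻¹) (sphere 0 r) := by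
  apply continuousOn_inv₀.mono
  intro z hz
  exact ne_of_mem_sphere hz hr.ne'

lemma bb_one (ht : t ^ 2 ≤ N ^ 2) (hN : 0 ≤ N) (hr : N < r) :
    bb n t N r 1 = n * t * bb n t N r 0 := by
  have h := circleIntegral.integral_eq_zero_of_hasDerivWithinAt (c := 0) (R := r) (by linarith)
    (fun z hz => (KK_q_deriv (n := n) ht hN hr (ζ := z) (by simpa using hz)).hasDerivWithinAt)
  have i1 := KK_int (n := n) ht hN hr (g := fun ζ => ζ ^ 1) (by fun_prop)
  have i0 := KK_int (n := n) ht hN hr (g := fun ζ => (n * t) * ζ ^ 0) (by fun_prop)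
  have im := KK_int (n := n) ht hN hr (g := fun ζ => ((n - 1) * N ^ 2) * ζ⁻¹)
    (continuousOn_const.mul (inv_cont (by linarith)))
  have e : (∮ z in C(0, r), KK n t N z * (z - n * t + (n - 1) * N ^ 2 * z⁻¹)) =
    (∮ ζ in C(0, r), ((ζ ^ 1 * KK n t N ζ - n * t * ζ ^ 0 * KK n t N ζ)
      + (n - 1) * N ^ 2 * ζ⁻¹ * KK n t N ζ)) := by
    congr 1; ext z; ring
  have i10 : CircleIntegrable (fun ζ : ℂ => ζ ^ 1 * KK n t N ζ - n * t * ζ ^ 0 * KK n t N ζ) 0 r :=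
    i1.sub i0
  rw [e, circleIntegral.integral_add i10 im, circleIntegral.integral_sub i1 i0] at h
  simp only [mul_assoc ((n : ℂ) * t), mul_assoc (((n : ℂ) - 1) * N ^ 2)] at h
  rw [circleIntegral.integral_const_mul, circleIntegral.integral_const_mul, bb_neg ht hN hr] at h
  simp only [bb]
  linear_combination h

lemma bb_rec (ht : t ^ 2 ≤ N ^ 2) (hN : 0 ≤ N) (hr : N < r) (j : ℕ) :
    (j + 2) * bb n t N r (j + 2) = (2 * j + 2 + n) * t * bb n t N r (j + 1)
      - (j + n) * N ^ 2 * bb n t N r j := by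
  have h := circleIntegral.integral_eq_zero_of_hasDerivWithinAt (c := 0) (R := r) (by linarith)
    (fun z hz => ((hasDerivAt_pow (j + 1) z).mul (KK_q_deriv (n := n) ht hN hr (ζ := z)
      (by simpa using hz))).hasDerivWithinAt)
  have i2 := KK_int (n := n) ht hN hr (g := fun ζ => ((j : ℂ) + 2) * ζ ^ (j + 2)) (by fun_prop)
  have i1 := KK_int (n := n) ht hN hr (g := fun ζ => ((2 * j + 2 + n : ℂ) * t) * ζ ^ (j + 1))
    (by fun_prop)
  have i0 := KK_int (n := n) ht hN hr (g := fun ζ => ((j + n : ℂ) * N ^ 2) * ζ ^ j) (by fun_prop)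
  have e : (∮ z in C(0, r), (((j + 1 : ℕ) : ℂ) * z ^ (j + 1 - 1) *
        ((z ^ 2 - 2 * t * z + N ^ 2) * KK n t N z)
        + z ^ (j + 1) * (KK n t N z * (z - n * t + (n - 1) * N ^ 2 * z⁻¹)))) =
    (∮ ζ in C(0, r), ((((j : ℂ) + 2) * ζ ^ (j + 2) * KK n t N ζ
      - ((2 * j + 2 + n : ℂ) * t) * ζ ^ (j + 1) * KK n t N ζ)
      + ((j + n : ℂ) * N ^ 2) * ζ ^ j * KK n t N ζ)) := by
    apply circleIntegral.integral_congr (by linarith)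
    intro z hz
    have hz0 : z ≠ 0 := ne_of_mem_sphere hz (by linarith)
    simp only [Nat.add_sub_cancel]
    push_cast
    field_simp
    ring
  have i21 : CircleIntegrable (fun ζ : ℂ => ((j : ℂ) + 2) * ζ ^ (j + 2) * KK n t N ζ
      - ((2 * j + 2 + n : ℂ) * t) * ζ ^ (j + 1) * KK n t N ζ) 0 r := i2.sub i1
  rw [e, circleIntegral.integral_add i21 i0, circleIntegral.integral_sub i2 i1] at h
  simp only [mul_assoc ((j : ℂ) + 2), mul_assoc ((2 * j + 2 + n : ℂ) * t),
    mul_assoc ((j + n : ℂ) * N ^ 2)] at h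
  rw [circleIntegral.integral_const_mul, circleIntegral.integral_const_mul,
    circleIntegral.integral_const_mul] at h
  simp only [bb]
  linear_combination h

end coeffs

lemma bb_eq {n : ℕ} (x θ : En n) (hθ : ‖θ‖ = 1) {r : ℝ} (hr : ‖x‖ < r) (k : ℕ) :
    bb n (inner ℝ θ x) ‖x‖ r k = 2 * Real.pi * Complex.I * evalR (GG x k) θ := by
  have ht : (inner ℝ θ x : ℝ) ^ 2 ≤ ‖x‖ ^ 2 := by
    have := abs_real_inner_le_norm θ x
    rw [hθ, one_mul] at this
    exact sq_le_sq.2 (by simpa using this)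
  have hN := norm_nonneg x
  suffices h : bb n (inner ℝ θ x) ‖x‖ r k = 2 * Real.pi * Complex.I * evalR (GG x k) θ ∧
    bb n (inner ℝ θ x) ‖x‖ r (k + 1) = 2 * Real.pi * Complex.I * evalR (GG x (k + 1)) θ from h.1
  induction k with
  | zero =>
    have h0 := bb_zero (n := n) ht hN hr
    refine ⟨by rw [h0]; simp [GG, evalR], ?_⟩
    rw [zero_add, bb_one ht hN hr, h0]
    simp only [GG, evalR_mul, evalR_C, evalR_TT]
    ring
  | succ k ih =>
    refine ⟨ih.2, ?_⟩
    have hk : (k + 2 : ℂ) ≠ 0 := by exact_mod_cast Nat.succ_ne_zero (k + 1)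
    apply mul_left_cancel₀ hk
    have h1 := bb_rec (n := n) ht hN hr k
    have h := congrArg (fun Q => evalR Q θ) (GG_rec x k)
    simp only [evalR_mul, evalR_sub, evalR_C, evalR_NN, hθ, XX_eq, evalR_TT] at h
    rw [ih.1, ih.2] at h1
    push_cast at h
    linear_combination h1 - 2 * Real.pi * Complex.I * h

lemma kernel_eq {n : ℕ} (hn : 2 ≤ n) (ζ : ℂ) (hζ : ζ ≠ 0) (θ x : En n) :
    ζ ^ (n - 1) / rPow n ζ θ x = KK n (inner ℝ θ x) ‖x‖ ζ := by
  obtain ⟨m, rfl⟩ : ∃ m, n = m + 1 := ⟨n - 1, by omega⟩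
  rw [rPow, KK, Complex.cpow_neg]
  simp only [div_eq_mul_inv, mul_inv, inv_pow, Nat.add_sub_cancel]
  rw [pow_succ, mul_inv]
  have : ζ ^ m ≠ 0 := pow_ne_zero _ hζ
  field_simp

/-- the pointwise identity -/
lemma pointwise {n : ℕ} (hn : 2 ≤ n) (P : MvPolynomial (Fin n) ℂ) (x : En n) {r : ℝ}
    (hr : ‖x‖ < r) :
    ∫ θ : sphere (0 : En n) 1, (∮ ζ in C(0, r), evalC P ζ (θ : En n) *
      (ζ ^ (n - 1) / rPow n ζ (θ : En n) x)) ∂(sphereMeasure n) =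
    2 * Real.pi * Complex.I * omegaN n * evalR P x := by
  have hr0 : 0 < r := lt_of_le_of_lt (norm_nonneg x) hr
  have hsum : ∀ (ζ : ℂ) (y : En n), evalC P ζ y = ∑ k ∈ Finset.range (P.totalDegree + 1),
      ζ ^ k * evalR (homogeneousComponent k P) y := by
    intro ζ y
    simp_rw [← evalC_homog (homogeneousComponent_isHomogeneous _ P)]
    conv_lhs => rw [← sum_homogeneousComponent P]
    simp [evalC]
  have hin : ∀ θ : sphere (0 : En n) 1, (∮ ζ in C(0, r), evalC P ζ (θ : En n) *
      (ζ ^ (n - 1) / rPow n ζ (θ : En n) x)) = ∑ k ∈ Finset.range (P.totalDegree + 1),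
      2 * Real.pi * Complex.I * evalR (homogeneousComponent k P * GG x k) (θ : En n) := by
    intro θ
    have hθ : ‖(θ : En n)‖ = 1 := by simp
    have ht : (inner ℝ (θ : En n) x : ℝ) ^ 2 ≤ ‖x‖ ^ 2 := by
      have := abs_real_inner_le_norm (θ : En n) x
      rw [hθ, one_mul] at this
      exact sq_le_sq.2 (by simpa using this)
    have e : (∮ ζ in C(0, r), evalC P ζ (θ : En n) * (ζ ^ (n - 1) / rPow n ζ (θ : En n) x)) =
      ∮ ζ in C(0, r), ∑ k ∈ Finset.range (P.totalDegree + 1),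
        evalR (homogeneousComponent k P) (θ : En n) *
          (ζ ^ k * KK n (inner ℝ (θ : En n) x) ‖x‖ ζ) := by
      apply circleIntegral.integral_congr hr0.le
      intro z hz
      simp only []
      rw [kernel_eq hn z (ne_of_mem_sphere hz hr0.ne'), hsum, Finset.sum_mul]
      exact Finset.sum_congr rfl fun k _ => by ring
    rw [e, circleIntegral.integral_fun_sum]
    · refine Finset.sum_congr rfl fun k _ => ?_
      rw [circleIntegral.integral_const_mul]
      have := bb_eq x (θ : En n) hθ hr k
      rw [bb] at this
      rw [this, evalR_mul]; ring
    · intro k _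
      have := KK_int (n := n) ht (norm_nonneg x) hr
        (g := fun ζ => evalR (homogeneousComponent k P) (θ : En n) * ζ ^ k) (by fun_prop)
      simpa only [mul_assoc] using this
  simp_rw [hin]
  rw [integral_finsetSum _ (fun k _ => (sphere_integrable _).const_mul _)]
  simp_rw [integral_const_mul, evalR_mul]
  simp_rw [fun k => reproduce hn x k _ (homogeneousComponent_isHomogeneous k P)]
  conv_rhs => rw [← sum_homogeneousComponent P]
  simp only [evalR, map_sum, Finset.mul_sum]
  exact Finset.sum_congr rfl fun k _ => by ring

/-! ### Fubini -/

/-- the full integrand -/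
def kern {n : ℕ} (P : MvPolynomial (Fin n) ℂ) (ζ : ℂ) (θ x : En n) : ℂ :=
  evalC P ζ θ * (ζ ^ (n - 1) / rPow n ζ θ x)

lemma evalC_continuous {n : ℕ} (P : MvPolynomial (Fin n) ℂ) :
    Continuous (fun p : ℂ × En n => evalC P p.1 p.2) := by
  unfold evalC
  have := MvPolynomial.continuous_eval P
  fun_prop

lemma kern_measurable {n : ℕ} (P : MvPolynomial (Fin n) ℂ) :
    Measurable (fun p : ℂ × En n × En n => kern P p.1 p.2.1 p.2.2) := by
  unfold kern rPow
  apply Measurable.mul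
  · exact ((evalC_continuous P).comp (by fun_prop : Continuous
      (fun p : ℂ × En n × En n => (p.1, p.2.1)))).measurable
  · refine Measurable.div (by fun_prop) (Measurable.mul (by fun_prop) ?_)
    refine Measurable.pow_const ?_ _
    have h1 : Measurable (fun p : ℂ × En n × En n => ((inner ℝ p.2.1 p.2.2 : ℝ) : ℂ)) := by
      apply Continuous.measurable; fun_prop
    have h2 : Measurable (fun p : ℂ × En n × En n => ((‖p.2.2‖ : ℝ) : ℂ)) := by
      apply Continuous.measurable; fun_prop
    exact ((measurable_const.sub ((h1.const_mul 2).div measurable_fst))).add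
      ((h2.pow_const 2).div (measurable_fst.pow_const 2))

lemma kern_bound {n : ℕ} (hn : 2 ≤ n) (P : MvPolynomial (Fin n) ℂ) {R r : ℝ} (hR : 0 ≤ R)
    (hr : R < r) : ∃ c : ℝ, ∀ (ζ : ℂ) (θ x : En n), ‖ζ‖ = r → ‖θ‖ = 1 → ‖x‖ ≤ R →
      ‖kern P ζ θ x‖ ≤ c := by
  have hr0 : 0 < r := by linarith
  have hc : IsCompact ((sphere (0 : ℂ) r) ×ˢ (sphere (0 : En n) 1) ×ˢ (closedBall (0 : En n) R)) :=
    (isCompact_sphere _ _).prod ((isCompact_sphere _ _).prod (isCompact_closedBall _ _))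
  obtain ⟨c, h⟩ := hc.exists_bound_of_continuousOn
    (f := fun p : ℂ × En n × En n => evalC P p.1 p.2.1 *
      KK n (inner ℝ p.2.1 p.2.2) ‖p.2.2‖ p.1) (by
    apply ContinuousOn.mul
    · exact ((evalC_continuous P).comp (by fun_prop : Continuous
        (fun p : ℂ × En n × En n => (p.1, p.2.1)))).continuousOn
    · unfold KK
      have hinv : ContinuousOn (fun p : ℂ × En n × En n => p.1⁻¹)
          ((sphere (0 : ℂ) r) ×ˢ (sphere (0 : En n) 1) ×ˢ (closedBall (0 : En n) R)) :=
        continuousOn_fst.inv₀ fun p hp => ne_of_mem_sphere hp.1 hr0.ne'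
      refine hinv.mul (ContinuousOn.cpow ?_ continuousOn_const ?_)
      · have h1 : Continuous (fun p : ℂ × En n × En n => ((inner ℝ p.2.1 p.2.2 : ℝ) : ℂ)) := by
          fun_prop
        have h2 : Continuous (fun p : ℂ × En n × En n => ((‖p.2.2‖ : ℝ) : ℂ)) := by fun_prop
        exact (continuousOn_const.sub ((continuousOn_const.mul h1.continuousOn).mul hinv)).add
          ((h2.pow 2).continuousOn.mul (hinv.pow 2))
      · intro p hp
        have hθ : ‖p.2.1‖ = 1 := by simpa using hp.2.1
        have hx : ‖p.2.2‖ ≤ R := by simpa using hp.2.2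
        refine ww_slit (r := r) ?_ (norm_nonneg _) (by linarith) (by simpa using hp.1)
        have := abs_real_inner_le_norm p.2.1 p.2.2
        rw [hθ, one_mul] at this
        exact sq_le_sq.2 (by simpa using this))
  refine ⟨c, fun ζ θ x hζ hθ hx => ?_⟩
  have := h (ζ, θ, x) ⟨by simpa using hζ, by simpa using hθ, by simpa using hx⟩
  rw [kern, kernel_eq hn ζ (by rw [← norm_pos_iff, hζ]; exact hr0)]
  exact this

section fub

variable {n : ℕ} {R r : ℝ} (ν : Measure (En n)) [IsFiniteMeasure ν]

lemma fub_ae {α : Type*} [MeasurableSpace α] (σ : Measure α) [SFinite σ]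
    (hν : ν (closedBall (0 : En n) R)ᶜ = 0) :
    ∀ᵐ p ∂(σ.prod ν), ‖p.2‖ ≤ R := by
  have h : ∀ᵐ x ∂ν, ‖x‖ ≤ R := by
    rw [ae_iff]
    convert hν using 2
    ext x; simp
  exact Measure.quasiMeasurePreserving_snd.ae h

lemma fub_int1 (hn : 2 ≤ n) (P : MvPolynomial (Fin n) ℂ) (hR : 0 ≤ R) (hr : R < r)
    (hν : ν (closedBall (0 : En n) R)ᶜ = 0) (ζ : ℂ) (hζ : ‖ζ‖ = r) :
    Integrable (fun p : sphere (0 : En n) 1 × En n => kern P ζ (p.1 : En n) p.2)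
      ((sphereMeasure n).prod ν) := by
  obtain ⟨c, hc⟩ := kern_bound hn P hR hr
  refine Integrable.of_bound (C := c) ?_ ?_
  · have hm : Measurable (fun p : sphere (0 : En n) 1 × En n => (ζ, (p.1 : En n), p.2)) := by
      fun_prop
    exact ((kern_measurable P).comp hm).aestronglyMeasurable
  · filter_upwards [fub_ae ν (sphereMeasure n) hν] with p hp
    exact hc _ _ _ hζ (by simp) hp

lemma fub_int2 (hn : 2 ≤ n) (P : MvPolynomial (Fin n) ℂ) (hR : 0 ≤ R) (hr : R < r)
    (hν : ν (closedBall (0 : En n) R)ᶜ = 0) :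
    Integrable (fun q : ℝ × (sphere (0 : En n) 1 × En n) =>
        kern P (circleMap 0 r q.1) (q.2.1 : En n) q.2.2)
      ((volume.restrict (Set.Ioc 0 (2 * Real.pi))).prod ((sphereMeasure n).prod ν)) := by
  obtain ⟨c, hc⟩ := kern_bound hn P hR hr
  refine Integrable.of_bound (C := c) ?_ ?_
  · have := (continuous_circleMap 0 r).measurable
    have hm : Measurable (fun q : ℝ × (sphere (0 : En n) 1 × En n) =>
        (circleMap 0 r q.1, (q.2.1 : En n), q.2.2)) := by
      fun_prop
    exact ((kern_measurable P).comp hm).aestronglyMeasurable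
  · have h := Measure.quasiMeasurePreserving_snd
      (μ := volume.restrict (Set.Ioc 0 (2 * Real.pi))) |>.ae (fub_ae ν (sphereMeasure n) hν)
    filter_upwards [h] with p hp
    refine hc _ _ _ ?_ (by simp) hp
    rw [norm_circleMap_zero, abs_of_pos (by linarith)]

lemma fub_int3 (hn : 2 ≤ n) (P : MvPolynomial (Fin n) ℂ) (hR : 0 ≤ R) (hr : R < r)
    (hν : ν (closedBall (0 : En n) R)ᶜ = 0) :
    Integrable (fun q : ℝ × (sphere (0 : En n) 1 × En n) =>
        deriv (circleMap 0 r) q.1 * kern P (circleMap 0 r q.1) (q.2.1 : En n) q.2.2)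
      ((volume.restrict (Set.Ioc 0 (2 * Real.pi))).prod ((sphereMeasure n).prod ν)) := by
  refine (fub_int2 ν hn P hR hr hν).bdd_mul (c := |r|) ?_ ?_
  · simp only [deriv_circleMap]
    have := (continuous_circleMap 0 r).measurable
    apply Measurable.aestronglyMeasurable
    fun_prop
  · refine Filter.Eventually.of_forall fun q => ?_
    simp [deriv_circleMap]

lemma fub_circleIntegrable (hn : 2 ≤ n) (P : MvPolynomial (Fin n) ℂ) (hR : 0 ≤ R) (hr : R < r)
    (hν : ν (closedBall (0 : En n) R)ᶜ = 0) :
    CircleIntegrable (fun ζ => ∫ p : sphere (0 : En n) 1 × En n, kern P ζ (p.1 : En n) p.2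
      ∂((sphereMeasure n).prod ν)) 0 r := by
  unfold CircleIntegrable
  rw [intervalIntegrable_iff_integrableOn_Ioc_of_le (by positivity)]
  exact (fub_int2 ν hn P hR hr hν).integral_prod_left

lemma fub_value (hn : 2 ≤ n) (P : MvPolynomial (Fin n) ℂ) (hR : 0 ≤ R) (hr : R < r)
    (hν : ν (closedBall (0 : En n) R)ᶜ = 0) :
    (∮ ζ in C(0, r), ∫ p : sphere (0 : En n) 1 × En n, kern P ζ (p.1 : En n) p.2
      ∂((sphereMeasure n).prod ν)) = 2 * Real.pi * Complex.I * omegaN n * ∫ x, evalR P x ∂ν := by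
  have h3 := fub_int3 ν hn P hR hr hν
  have hae : ∀ᵐ x ∂ν, ‖x‖ ≤ R := by
    rw [ae_iff]
    convert hν using 2
    ext x; simp
  have hci : ∀ f : ℂ → ℂ, (∮ ζ in C(0, r), f ζ) = ∫ t in Set.Ioc 0 (2 * Real.pi),
      deriv (circleMap 0 r) t * f (circleMap 0 r t) := fun f => by
    rw [circleIntegral, intervalIntegral.integral_of_le (by positivity)]; rfl
  rw [hci]
  simp_rw [← integral_const_mul]
  rw [integral_integral_swap h3, integral_prod_symm _ h3.integral_prod_right]
  refine integral_congr_ae ?_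
  filter_upwards [hae] with x hx
  rw [← pointwise hn P x (lt_of_le_of_lt hx hr)]
  refine integral_congr_ae (Filter.Eventually.of_forall fun θ => ?_)
  exact (hci (fun ζ => kern P ζ (θ : En n) x)).symm

end fub

lemma omegaN_ne {n : ℕ} (hn : 2 ≤ n) : (omegaN n : ℂ) ≠ 0 := by
  have hd : Module.finrank ℝ (En n) = n := by simp
  have h : omegaN n = n * (volume : Measure (En n)).real (ball 0 1) := by
    have := (volume : Measure (En n)).toSphere_real_apply_univ
    rw [hd] at this
    rw [← this]; rfl
  have h1 : 0 < (volume : Measure (En n)).real (ball 0 1) :=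
    ENNReal.toReal_pos (measure_ball_pos _ _ one_pos).ne' measure_ball_lt_top.ne
  have : 0 < omegaN n := by
    rw [h]
    have : (0 : ℝ) < n := by exact_mod_cast (by omega : 0 < n)
    positivity
  exact_mod_cast this.ne'

/-- `(1/(2πi)) ∮_{Γ_{R₁}} ∫_{S^{n-1}} P(ζθ) μ̂(ζ,θ) dθ dζ = ∫ P dμ`. -/
theorem circleIntegral_markov_eq_integral
    (n : ℕ) (hn : 2 ≤ n) (R R₁ : ℝ) (hR₁ : R < R₁)
    (μ : SignedMeasure (En n)) (hμ : SuppIn μ (closedBall (0 : En n) R))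
    (P : MvPolynomial (Fin n) ℂ) :
    (2 * Real.pi * Complex.I)⁻¹ *
      (∮ ζ in C(0, R₁), ∫ θ : sphere (0 : En n) 1,
        evalC P ζ (θ : En n) * markov μ ζ (θ : En n) ∂(sphereMeasure n))
    = sInt μ (fun x => evalR P x) := by
  have hpi : (2 * Real.pi * Complex.I : ℂ) ≠ 0 := Complex.two_pi_I_ne_zero
  rw [SuppIn, SignedMeasure.totalVariation, Measure.add_apply, add_eq_zero] at hμ
  obtain ⟨hp, hm⟩ := hμ
  rcases lt_or_ge R 0 with hR | hR
  · rw [closedBall_eq_empty.2 hR, Set.compl_empty, Measure.measure_univ_eq_zero] at hp hm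
    simp [markov, sInt, hp, hm, circleIntegral]
  · simp only [markov, sInt]
    set νp := μ.toJordanDecomposition.posPart
    set νm := μ.toJordanDecomposition.negPart
    have hω := omegaN_ne hn
    have key : (∮ ζ in C(0, R₁), ∫ θ : sphere (0 : En n) 1, evalC P ζ (θ : En n) *
        ((omegaN n : ℂ)⁻¹ * (∫ x, ζ ^ (n - 1) / rPow n ζ (θ : En n) x ∂νp
          - ∫ x, ζ ^ (n - 1) / rPow n ζ (θ : En n) x ∂νm)) ∂(sphereMeasure n)) =
        ∮ ζ in C(0, R₁), (omegaN n : ℂ)⁻¹ *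
          ((∫ p : sphere (0 : En n) 1 × En n, kern P ζ (p.1 : En n) p.2 ∂((sphereMeasure n).prod νp))
          - ∫ p : sphere (0 : En n) 1 × En n, kern P ζ (p.1 : En n) p.2
            ∂((sphereMeasure n).prod νm)) := by
      apply circleIntegral.integral_congr (by linarith)
      intro ζ hζ
      have hζ' : ‖ζ‖ = R₁ := by simpa using hζ
      have ip := fub_int1 νp hn P hR hR₁ hp ζ hζ'
      have im := fub_int1 νm hn P hR hR₁ hm ζ hζ'
      beta_reduce
      rw [integral_prod _ ip, integral_prod _ im,
        ← integral_sub ip.integral_prod_left im.integral_prod_left, ← integral_const_mul]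
      refine integral_congr_ae (Filter.Eventually.of_forall fun θ => ?_)
      simp only [kern, integral_const_mul]
      ring
    rw [key, circleIntegral.integral_const_mul, circleIntegral.integral_sub
      (fub_circleIntegrable νp hn P hR hR₁ hp) (fub_circleIntegrable νm hn P hR hR₁ hm),
      fub_value νp hn P hR hR₁ hp, fub_value νm hn P hR hR₁ hm]
    field_simp
end
end
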